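/- arXiv:1310.1860 — 2 statements merged into one kernel-verified Lean document; each statement's English description precedes it below -/
import Mathlib

section
/- Let G be a countable simple graph and let (G,p) be a bar-joint framework in a finite-dimensional real normed space (X,‖·‖). Then the following are equivalent: (i) (G,p) is infinitesimally rigid; (ii) (G,p) contains a vertex-complete tower which has the flex cancellation property; (iii) (G,p) contains a vertex-complete tower which is relatively infinitesimally rigid. -/
open Asymptotics Filter Topology Set

open scoped Classical

noncomputable section

namespace RigidityPaper

variable {V X E : Type}

/-- `p` is a placement of the graph `G`: adjacent vertices are placed at distinct points. -/
def IsPlacement (G : SimpleGraph V) (p : V → X) : Prop :=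
  ∀ ⦃v w⦄, G.Adj v w → p v ≠ p w

section NormedSpace

variable [NormedAddCommGroup X] [NormedSpace ℝ X]

/-- `u` is an infinitesimal flex of the framework `(G,p)` in the normed space `X`. -/
def IsFlex (G : SimpleGraph V) (p u : V → X) : Prop :=
  ∀ ⦃v w⦄, G.Adj v w →
    (fun t : ℝ => ‖(p v + t • u v) - (p w + t • u w)‖ - ‖p v - p w‖)
      =o[𝓝 (0 : ℝ)] (fun t : ℝ => t)

/-- A continuous rigid motion of the normed space `X`. -/
def IsContRigidMotion (Γ : X → ℝ → X) : Prop :=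
  (∀ t ∈ Icc (-1 : ℝ) 1, Isometry (fun x => Γ x t)) ∧
    (∀ x, ContinuousOn (Γ x) (Icc (-1 : ℝ) 1)) ∧ ∀ x, Γ x 0 = x

/-- An infinitesimal rigid motion of the normed space `X`. -/
def IsInfRigidMotion (γ : X → X) : Prop :=
  ∃ Γ, IsContRigidMotion Γ ∧ ∀ x, HasDerivWithinAt (Γ x) (γ x) (Icc (-1 : ℝ) 1) 0

/-- `u` is a trivial (infinitesimal) flex on the vertex set `S`. -/
def IsTrivialOn (p : V → X) (S : Set V) (u : V → X) : Prop :=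
  ∃ γ, IsInfRigidMotion γ ∧ ∀ v ∈ S, u v = γ (p v)

/-- The framework `(G,p)` is infinitesimally rigid. -/
def InfRigid (G : SimpleGraph V) (p : V → X) : Prop :=
  ∀ u, IsFlex G p u → IsTrivialOn p univ u

end NormedSpace

/-- A tower of finite subgraphs of `G`. -/
structure Tower (G : SimpleGraph V) where
  seq : ℕ → G.Subgraph
  mono : ∀ k, seq k ≤ seq (k + 1)
  finite : ∀ k, (seq k).verts.Finite

variable {G : SimpleGraph V}

/-- A tower is vertex-complete if its vertex sets exhaust the vertices of `G`. -/
def VertexComplete (T : Tower G) : Prop := (⋃ k, (T.seq k).verts) = univ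

/-- A tower is edge-complete if its edges exhaust the edges of `G`. -/
def EdgeComplete (T : Tower G) : Prop := ∀ ⦃v w⦄, G.Adj v w → ∃ k, (T.seq k).Adj v w

section NormedSpace

variable [NormedAddCommGroup X] [NormedSpace ℝ X]

/-- The flex cancellation property of a tower of frameworks: every non-trivial
infinitesimal flex of the `k`-th framework fails to extend to some later framework. -/
def FlexCancel (T : Tower G) (p : V → X) : Prop :=
  ∀ k u, IsFlex (T.seq k).spanningCoe p u → ¬ IsTrivialOn p (T.seq k).verts u →
    ∃ m, k < m ∧
      ¬ ∃ u', IsFlex (T.seq m).spanningCoe p u' ∧ ∀ v ∈ (T.seq k).verts, u' v = u v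

/-- A tower of frameworks is relatively infinitesimally rigid: no non-trivial
infinitesimal flex of the `k`-th framework extends to the `(k+1)`-st framework. -/
def RelRigidTower (T : Tower G) (p : V → X) : Prop :=
  ∀ k u, IsFlex (T.seq k).spanningCoe p u →
    (∃ u', IsFlex (T.seq (k + 1)).spanningCoe p u' ∧ ∀ v ∈ (T.seq k).verts, u' v = u v) →
    IsTrivialOn p (T.seq k).verts u

/-- The subframework on the subgraph `H` is infinitesimally rigid. -/
def SubInfRigid (H : G.Subgraph) (p : V → X) : Prop :=
  ∀ u, IsFlex H.spanningCoe p u → IsTrivialOn p H.verts u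

/-- The framework `(G,p)` is sequentially infinitesimally rigid. -/
def SeqInfRigid (G : SimpleGraph V) (p : V → X) : Prop :=
  ∃ T : Tower G, VertexComplete T ∧ ∀ k, SubInfRigid (T.seq k) p

end NormedSpace

/-! ### The `ℓ^q` norms on `ℝ^d` -/

/-- The `ℓ^q` norm on `ℝ^d`. -/
def qnorm (q : ℝ) {d : ℕ} (x : Fin d → ℝ) : ℝ := (∑ i, |x i| ^ q) ^ (1 / q)

/-- `u` is an infinitesimal flex of `(G,p)` in `(ℝ^d, ‖·‖_q)`. -/
def IsQFlex (q : ℝ) {d : ℕ} (G : SimpleGraph V) (p u : V → Fin d → ℝ) : Prop :=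
  ∀ ⦃v w⦄, G.Adj v w →
    (fun t : ℝ => qnorm q ((p v + t • u v) - (p w + t • u w)) - qnorm q (p v - p w))
      =o[𝓝 (0 : ℝ)] (fun t : ℝ => t)

/-- A continuous rigid motion of `(ℝ^d, ‖·‖_q)`. -/
def IsQContRigidMotion (q : ℝ) {d : ℕ} (Γ : (Fin d → ℝ) → ℝ → Fin d → ℝ) : Prop :=
  (∀ t ∈ Icc (-1 : ℝ) 1, ∀ x y, qnorm q (Γ x t - Γ y t) = qnorm q (x - y)) ∧
    (∀ x, ContinuousOn (Γ x) (Icc (-1 : ℝ) 1)) ∧ ∀ x, Γ x 0 = x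

/-- An infinitesimal rigid motion of `(ℝ^d, ‖·‖_q)`. -/
def IsQInfRigidMotion (q : ℝ) {d : ℕ} (γ : (Fin d → ℝ) → Fin d → ℝ) : Prop :=
  ∃ Γ, IsQContRigidMotion q Γ ∧ ∀ x, HasDerivWithinAt (Γ x) (γ x) (Icc (-1 : ℝ) 1) 0

/-- `u` is a trivial flex on the vertex set `S`, for the `ℓ^q` norm. -/
def IsQTrivialOn (q : ℝ) {d : ℕ} (p : V → Fin d → ℝ) (S : Set V) (u : V → Fin d → ℝ) : Prop :=
  ∃ γ, IsQInfRigidMotion q γ ∧ ∀ v ∈ S, u v = γ (p v)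

/-- The framework `(G,p)` is infinitesimally rigid in `(ℝ^d, ‖·‖_q)`. -/
def QInfRigid (q : ℝ) {d : ℕ} (G : SimpleGraph V) (p : V → Fin d → ℝ) : Prop :=
  ∀ u, IsQFlex q G p u → IsQTrivialOn q p univ u

/-- The subframework on the subgraph `H` is infinitesimally rigid in `(ℝ^d, ‖·‖_q)`. -/
def QSubInfRigid (q : ℝ) {d : ℕ} (H : G.Subgraph) (p : V → Fin d → ℝ) : Prop :=
  ∀ u, IsQFlex q H.spanningCoe p u → IsQTrivialOn q p H.verts u

/-! ### The rigidity matrix, regular and generic placements -/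

/-- The entry `sgn(a-b)|a-b|^{q-1}` of the rigidity matrix. -/
def rigidityCoef (q : ℝ) (a b : ℝ) : ℝ := Real.sign (a - b) * |a - b| ^ (q - 1)

/-- The row of the rigidity matrix `R_q(G,p)` corresponding to the (oriented) edge `vw`,
regarded as a vector in `ℝ^{V × d}`. -/
def rigidityRow (q : ℝ) {d : ℕ} (p : V → Fin d → ℝ) (v w : V) : V × Fin d → ℝ :=
  fun x =>
    (if x.1 = v then rigidityCoef q (p v x.2) (p w x.2) else 0) -
      (if x.1 = w then rigidityCoef q (p v x.2) (p w x.2) else 0)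

/-- The rank of the rigidity matrix `R_q(G,p)`, i.e. the dimension of its row space. -/
def rigidityRank (q : ℝ) {d : ℕ} (G : SimpleGraph V) (p : V → Fin d → ℝ) : ℕ :=
  Module.finrank ℝ
    (Submodule.span ℝ {r : V × Fin d → ℝ | ∃ v w, G.Adj v w ∧ r = rigidityRow q p v w})

/-- `(G,p)` is a regular framework in `(ℝ^d, ‖·‖_q)`: the rank of the rigidity matrix is
maximal at `p` over all placements of `G`. -/
def IsRegular (q : ℝ) {d : ℕ} (G : SimpleGraph V) (p : V → Fin d → ℝ) : Prop :=
  IsPlacement G p ∧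
    ∀ x : V → Fin d → ℝ, IsPlacement G x → rigidityRank q G x ≤ rigidityRank q G p

/-- `p` restricts on `W` to a generic placement: it is injective on `W` (a placement of the
complete graph on `W`) and every subframework of the complete graph on `W` is regular. -/
def GenericOn (q : ℝ) {d : ℕ} (p : V → Fin d → ℝ) (W : Set V) : Prop :=
  InjOn p W ∧ ∀ W' : Set V, W' ⊆ W → ∀ H : SimpleGraph W', IsRegular q H (fun x : W' => p x.1)

/-- `p` is a generic placement in `(ℝ^d, ‖·‖_q)`: its restriction to every finite set of
vertices is generic. -/
def IsGeneric (q : ℝ) {d : ℕ} (p : V → Fin d → ℝ) : Prop :=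
  ∀ W : Set V, W.Finite → GenericOn q p W

/-- The graph `G` is rigid in `(ℝ^d, ‖·‖_q)`: every generic placement is infinitesimally
rigid. -/
def Rigid (q : ℝ) (d : ℕ) (G : SimpleGraph V) : Prop :=
  ∀ p : V → Fin d → ℝ, IsGeneric q p → QInfRigid q G p

/-- The graph `G` is sequentially rigid in `(ℝ^d, ‖·‖_q)`: every generic placement is
sequentially infinitesimally rigid. -/
def SeqRigid (q : ℝ) (d : ℕ) (G : SimpleGraph V) : Prop :=
  ∀ p : V → Fin d → ℝ, IsGeneric q p →
    ∃ T : Tower G, VertexComplete T ∧ ∀ k, QSubInfRigid q (T.seq k) p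

/-- The graph `G` is minimally rigid in `(ℝ^d, ‖·‖_q)`. -/
def MinRigid (q : ℝ) (d : ℕ) (G : SimpleGraph V) : Prop :=
  Rigid q d G ∧
    ∀ p : V → Fin d → ℝ, IsGeneric q p → ∀ ⦃v w⦄, G.Adj v w →
      ¬ QInfRigid q (G.deleteEdges {s(v, w)}) p

/-! ### Continuous rigidity in `(ℝ^d, ‖·‖_q)` -/

/-- `α` is a continuous flex of `(G,p)` in `(ℝ^d, ‖·‖_q)`. -/
def IsQContFlex (q : ℝ) {d : ℕ} (G : SimpleGraph V) (p : V → Fin d → ℝ)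
    (α : V → ℝ → Fin d → ℝ) : Prop :=
  (∀ v, ContinuousOn (α v) (Icc (-1 : ℝ) 1)) ∧ (∀ v, α v 0 = p v) ∧
    ∀ ⦃v w⦄, G.Adj v w → ∀ t ∈ Icc (-1 : ℝ) 1, qnorm q (α v t - α w t) = qnorm q (p v - p w)

/-- `(G,p)` is continuously rigid in `(ℝ^d, ‖·‖_q)`: every continuous flex is trivial,
that is, derived from a continuous rigid motion. -/
def QContRigid (q : ℝ) {d : ℕ} (G : SimpleGraph V) (p : V → Fin d → ℝ) : Prop :=
  ∀ α, IsQContFlex q G p α →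
    ∃ Γ, IsQContRigidMotion q Γ ∧ ∀ v, ∀ t ∈ Icc (-1 : ℝ) 1, α v t = Γ (p v) t

/-! ### Sparsity counts -/

/-- A subgraph `H` is `(k,l)`-sparse. -/
def SubSparse (k l : ℕ) (H : G.Subgraph) : Prop :=
  ∀ H' : G.Subgraph, H' ≤ H → 2 ≤ H'.verts.ncard →
    (H'.edgeSet.ncard : ℤ) ≤ (k * H'.verts.ncard : ℤ) - l

/-- A subgraph `H` is `(k,l)`-tight. -/
def SubTight (k l : ℕ) (H : G.Subgraph) : Prop :=
  SubSparse k l H ∧ (H.edgeSet.ncard : ℤ) = (k * H.verts.ncard : ℤ) - l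

/-- A simple graph `G` (on its whole vertex type) is `(k,l)`-sparse. -/
def GraphSparse (k l : ℕ) (G : SimpleGraph V) : Prop :=
  ∀ H : G.Subgraph, 2 ≤ H.verts.ncard →
    (H.edgeSet.ncard : ℤ) ≤ (k * H.verts.ncard : ℤ) - l

/-! ### Graph moves -/

/-- Henneberg vertex extension move of degree 2: adjoin a new vertex `v` together with
edges to two distinct existing vertices. -/
def HennVertexMove (H H' : (⊤ : SimpleGraph V).Subgraph) : Prop :=
  ∃ v v₁ v₂, v ∉ H.verts ∧ v₁ ∈ H.verts ∧ v₂ ∈ H.verts ∧ v₁ ≠ v₂ ∧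
    H'.verts = insert v H.verts ∧
    ∀ a b, H'.Adj a b ↔
      (H.Adj a b ∨ (a = v ∧ (b = v₁ ∨ b = v₂)) ∨ (b = v ∧ (a = v₁ ∨ a = v₂)))

/-- Henneberg edge move of degree 2: remove an edge `v₁v₂` and adjoin a new vertex `v`
together with edges to `v₁`, `v₂` and a third existing vertex `v₃`. -/
def HennEdgeMove (H H' : (⊤ : SimpleGraph V).Subgraph) : Prop :=
  ∃ v v₁ v₂ v₃, v ∉ H.verts ∧ v₁ ∈ H.verts ∧ v₂ ∈ H.verts ∧ v₃ ∈ H.verts ∧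
    H.Adj v₁ v₂ ∧ v₃ ≠ v₁ ∧ v₃ ≠ v₂ ∧
    H'.verts = insert v H.verts ∧
    ∀ a b, H'.Adj a b ↔
      ((H.Adj a b ∧ ¬((a = v₁ ∧ b = v₂) ∨ (a = v₂ ∧ b = v₁))) ∨
        (a = v ∧ (b = v₁ ∨ b = v₂ ∨ b = v₃)) ∨ (b = v ∧ (a = v₁ ∨ a = v₂ ∨ a = v₃)))

/-- Vertex-to-`K₄` move: a vertex `w₀` is chosen, three new vertices `w₁,w₂,w₃` are
adjoined together with all edges among `{w₀,w₁,w₂,w₃}`, and every edge `xw₀` is either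
kept or replaced by an edge `x(f x)` with `f x ∈ {w₀,w₁,w₂,w₃}`. -/
def VertexToK4Move (H H' : (⊤ : SimpleGraph V).Subgraph) : Prop :=
  ∃ w₀ w₁ w₂ w₃, w₀ ∈ H.verts ∧ w₁ ∉ H.verts ∧ w₂ ∉ H.verts ∧ w₃ ∉ H.verts ∧
    w₁ ≠ w₂ ∧ w₁ ≠ w₃ ∧ w₂ ≠ w₃ ∧
    ∃ f : V → V, (∀ x, f x = w₀ ∨ f x = w₁ ∨ f x = w₂ ∨ f x = w₃) ∧
      H'.verts = insert w₁ (insert w₂ (insert w₃ H.verts)) ∧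
      ∀ a b, H'.Adj a b ↔
        ((H.Adj a b ∧ a ≠ w₀ ∧ b ≠ w₀) ∨
          (∃ x, H.Adj x w₀ ∧ ((a = x ∧ b = f x) ∨ (b = x ∧ a = f x))) ∨
          (a ∈ ({w₀, w₁, w₂, w₃} : Set V) ∧ b ∈ ({w₀, w₁, w₂, w₃} : Set V) ∧ a ≠ b))

/-- Vertex-to-4-cycle move: a vertex `v` with neighbours `v₁,v₂` is chosen, a new vertex
`v₀` is adjoined together with the edges `v₀v₁`, `v₀v₂`, and every other edge `vw` is
either kept or replaced by the edge `v₀w`. -/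
def VertexTo4CycleMove (H H' : (⊤ : SimpleGraph V).Subgraph) : Prop :=
  ∃ v v₀ v₁ v₂, v ∈ H.verts ∧ v₀ ∉ H.verts ∧ v₁ ≠ v₂ ∧
    H.Adj v v₁ ∧ H.Adj v v₂ ∧
    ∃ f : V → V, (∀ x, f x = v ∨ f x = v₀) ∧
      H'.verts = insert v₀ H.verts ∧
      ∀ a b, H'.Adj a b ↔
        ((H.Adj a b ∧ a ≠ v ∧ b ≠ v) ∨
          ((a = v ∨ a = v₀) ∧ (b = v₁ ∨ b = v₂)) ∨
          ((b = v ∨ b = v₀) ∧ (a = v₁ ∨ a = v₂)) ∨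
          (∃ w, H.Adj v w ∧ w ≠ v₁ ∧ w ≠ v₂ ∧ ((a = f w ∧ b = w) ∨ (b = f w ∧ a = w))))

/-! ### Multigraphs -/

/-- `(V',E')` is a subgraph of the multigraph with edge-endpoint map `ends`. -/
def MGSubgraph (ends : E → Sym2 V) (V' : Set V) (E' : Set E) : Prop :=
  ∀ e ∈ E', ∀ v ∈ ends e, v ∈ V'

/-- The (multigraph) subgraph `(V',E')` is `(k,l)`-sparse. -/
def MGSparseOn (k l : ℕ) (ends : E → Sym2 V) (V' : Set V) (E' : Set E) : Prop :=
  ∀ (V'' : Set V) (E'' : Set E), V'' ⊆ V' → E'' ⊆ E' → MGSubgraph ends V'' E'' →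
    2 ≤ V''.ncard → (E''.ncard : ℤ) ≤ (k * V''.ncard : ℤ) - l

/-- The (multigraph) subgraph `(V',E')` is `(k,l)`-tight. -/
def MGTightOn (k l : ℕ) (ends : E → Sym2 V) (V' : Set V) (E' : Set E) : Prop :=
  MGSparseOn k l ends V' E' ∧ (E'.ncard : ℤ) = (k * V'.ncard : ℤ) - l

/-- The degree of a vertex in a loopless multigraph. -/
def mgDeg (ends : E → Sym2 V) (v : V) : ℕ := {e | v ∈ ends e}.ncard

section Aux

variable {V X : Type} [NormedAddCommGroup X] [NormedSpace ℝ X]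

def DirFlat (a x : X) : Prop :=
  (fun t : ℝ => ‖a + t • x‖ - ‖a‖) =o[𝓝 (0 : ℝ)] (fun t : ℝ => t)

theorem isFlex_iff (G : SimpleGraph V) (p u : V → X) :
    IsFlex G p u ↔ ∀ ⦃v w⦄, G.Adj v w → DirFlat (p v - p w) (u v - u w) := by
  have h : ∀ v w, (fun t : ℝ => ‖(p v + t • u v) - (p w + t • u w)‖ - ‖p v - p w‖) =
      fun t : ℝ => ‖(p v - p w) + t • (u v - u w)‖ - ‖p v - p w‖ := by
    intro v w
    funext t
    congr 2
    rw [smul_sub]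
    abel
  unfold IsFlex DirFlat
  simp only [h]

theorem DirFlat.zero (a : X) : DirFlat a 0 := by
  simp [DirFlat]

theorem DirFlat.smul {a x : X} (h : DirFlat a x) (c : ℝ) : DirFlat a (c • x) := by
  have ht : Tendsto (fun t : ℝ => t * c) (𝓝 0) (𝓝 0) := by
    have : Continuous (fun t : ℝ => t * c) := by fun_prop
    simpa using this.tendsto 0
  have h1 := IsLittleO.comp_tendsto h ht
  have h2 : ((fun t : ℝ => t) ∘ fun t : ℝ => t * c) =O[𝓝 (0 : ℝ)] (fun t : ℝ => t) := by
    apply IsBigO.of_bound |c|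
    refine Eventually.of_forall fun t => ?_
    simp [mul_comm]
  have h3 := h1.trans_isBigO h2
  unfold DirFlat
  refine h3.congr_left fun t => ?_
  simp [mul_smul]

theorem DirFlat.add {a x y : X} (hx : DirFlat a x) (hy : DirFlat a y) : DirFlat a (x + y) := by
  have hx2 := hx.smul 2
  have hy2 := hy.smul 2
  have hs : (fun t : ℝ => (‖a + t • ((2 : ℝ) • x)‖ - ‖a‖) + (‖a + t • ((2 : ℝ) • y)‖ - ‖a‖))
      =o[𝓝 (0 : ℝ)] (fun t : ℝ => t) := IsLittleO.add hx2 hy2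
  have hx3 := hx.smul (-2)
  have hy3 := hy.smul (-2)
  have hs' : (fun t : ℝ => (‖a + t • ((-2 : ℝ) • x)‖ - ‖a‖) +
      (‖a + t • ((-2 : ℝ) • y)‖ - ‖a‖))
      =o[𝓝 (0 : ℝ)] (fun t : ℝ => t) := IsLittleO.add hx3 hy3
  have htot := hs.norm_left.add hs'.norm_left
  refine IsBigO.trans_isLittleO (IsBigO.of_bound 1 (Eventually.of_forall fun t => ?_)) htot
  have e1 : ‖a + t • (x + y)‖ * 2 ≤ ‖a + t • ((2 : ℝ) • x)‖ + ‖a + t • ((2 : ℝ) • y)‖ := by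
    have : (2 : ℝ) • (a + t • (x + y)) =
        (a + t • ((2 : ℝ) • x)) + (a + t • ((2 : ℝ) • y)) := by module
    have h := norm_add_le (a + t • ((2 : ℝ) • x)) (a + t • ((2 : ℝ) • y))
    rw [← this, norm_smul] at h
    norm_num at h ⊢
    linarith
  have e2 : ‖a - t • (x + y)‖ * 2 ≤ ‖a + t • ((-2 : ℝ) • x)‖ + ‖a + t • ((-2 : ℝ) • y)‖ := by
    have : (2 : ℝ) • (a - t • (x + y)) =
        (a + t • ((-2 : ℝ) • x)) + (a + t • ((-2 : ℝ) • y)) := by module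
    have h := norm_add_le (a + t • ((-2 : ℝ) • x)) (a + t • ((-2 : ℝ) • y))
    rw [← this, norm_smul] at h
    norm_num at h ⊢
    linarith
  have e3 : 2 * ‖a‖ ≤ ‖a + t • (x + y)‖ + ‖a - t • (x + y)‖ := by
    have : (2 : ℝ) • a = (a + t • (x + y)) + (a - t • (x + y)) := by module
    have h := norm_add_le (a + t • (x + y)) (a - t • (x + y))
    rw [← this, norm_smul] at h
    norm_num at h ⊢
    linarith
  simp only [Real.norm_eq_abs, one_mul]
  set A := ‖a + t • ((2 : ℝ) • x)‖ - ‖a‖ + (‖a + t • ((2 : ℝ) • y)‖ - ‖a‖) with hA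
  set B := ‖a + t • ((-2 : ℝ) • x)‖ - ‖a‖ + (‖a + t • ((-2 : ℝ) • y)‖ - ‖a‖) with hB
  have hAB : |(|A| + |B|)| = |A| + |B| := abs_of_nonneg (by positivity)
  rw [hAB, abs_le]
  have := le_abs_self A
  have := le_abs_self B
  have := abs_nonneg A
  have := abs_nonneg B
  constructor <;> linarith

def flexSpace (G : SimpleGraph V) (p : V → X) : Submodule ℝ (V → X) where
  carrier := {u | IsFlex G p u}
  zero_mem' := by
    simp only [mem_setOf_eq, isFlex_iff]
    intro v w _
    simpa using DirFlat.zero _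
  add_mem' := by
    intro u u' h h'
    simp only [mem_setOf_eq, isFlex_iff] at *
    intro v w hvw
    have := (h hvw).add (h' hvw)
    simp only [Pi.add_apply]
    rwa [add_sub_add_comm]
  smul_mem' := by
    intro c u h
    simp only [mem_setOf_eq, isFlex_iff] at *
    intro v w hvw
    have := (h hvw).smul c
    simp only [Pi.smul_apply]
    rwa [← smul_sub]

theorem mem_flexSpace {G : SimpleGraph V} {p u : V → X} : u ∈ flexSpace G p ↔ IsFlex G p u :=
  Iff.rfl

theorem IsFlex.mono {G H : SimpleGraph V} {p u : V → X} (h : ∀ v w, G.Adj v w → H.Adj v w)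
    (hu : IsFlex H p u) : IsFlex G p u := fun v w hvw => hu (h v w hvw)

/-- Stabilisation of the restrictions of a decreasing sequence of subspaces. -/
theorem stab [FiniteDimensional ℝ X] (F : ℕ → Submodule ℝ (V → X)) (hF : Antitone F)
    (S : Set V) (hS : S.Finite) (k : ℕ) :
    ∃ N, k < N ∧ ∀ u : V → X, (∃ f ∈ F N, ∀ v ∈ S, f v = u v) →
      ∀ m, ∃ f ∈ F m, ∀ v ∈ S, f v = u v := by
  have : Finite S := hS
  let ρ : (V → X) →ₗ[ℝ] (S → X) := LinearMap.funLeft ℝ X (Subtype.val)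
  let R : ℕ →o (Submodule ℝ (S → X))ᵒᵈ :=
    ⟨fun m => OrderDual.toDual ((F m).map ρ), fun a b hab => Submodule.map_mono (hF hab)⟩
  obtain ⟨n, hn⟩ := IsArtinian.monotone_stabilizes R
  have key : ∀ m, ∀ u : V → X, (∃ f ∈ F m, ∀ v ∈ S, f v = u v) ↔ ρ u ∈ (F m).map ρ := by
    intro m u
    rw [Submodule.mem_map]
    refine exists_congr fun f => and_congr_right fun _ => ?_
    rw [funext_iff, Subtype.forall]
    rfl
  refine ⟨max n (k + 1), by omega, fun u hu m => ?_⟩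
  rw [key] at hu ⊢
  have h1 : (F n).map ρ = (F (max n (k + 1))).map ρ := hn _ (le_max_left _ _)
  rw [← h1] at hu
  have h2 : (F n).map ρ = (F (max n m)).map ρ := hn _ (le_max_left _ _)
  rw [h2] at hu
  exact Submodule.map_mono (hF (le_max_right _ _)) hu

theorem extend_all [FiniteDimensional ℝ X] (F : ℕ → Submodule ℝ (V → X)) (hF : Antitone F)
    (S : ℕ → Set V) (hSm : Monotone S) (hS : ∀ k, (S k).Finite) (k : ℕ) (u : V → X)
    (hu : ∀ m, ∃ f ∈ F m, ∀ v ∈ S k, f v = u v) (hc : ∀ v, ∃ j, v ∈ S j) :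
    ∃ w : V → X, (∀ v ∈ S k, w v = u v) ∧ ∀ j, ∃ f ∈ F j, ∀ v ∈ S j, f v = w v := by
  have step : ∀ (j : ℕ) (u : {u : V → X // ∀ m, ∃ f ∈ F m, ∀ v ∈ S j, f v = u v}),
      ∃ u' : {u : V → X // ∀ m, ∃ f ∈ F m, ∀ v ∈ S (j + 1), f v = u v},
        ∀ v ∈ S j, u'.1 v = u.1 v := by
    rintro j ⟨u, hu⟩
    obtain ⟨N, -, hN⟩ := stab F hF (S (j + 1)) (hS _) 0
    obtain ⟨f, hf, hfu⟩ := hu N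
    exact ⟨⟨f, hN f ⟨f, hf, fun _ _ => rfl⟩⟩, hfu⟩
  choose nx hnx using step
  let U : ∀ j, {u : V → X // ∀ m, ∃ f ∈ F m, ∀ v ∈ S (k + j), f v = u v} :=
    fun j => Nat.rec ⟨u, hu⟩ (fun j x => nx (k + j) x) j
  have hU0 : (U 0).1 = u := rfl
  have hU : ∀ j, ∀ v ∈ S (k + j), (U (j + 1)).1 v = (U j).1 v := fun j => hnx (k + j) (U j)
  have hU' : ∀ i j, i ≤ j → ∀ v ∈ S (k + i), (U j).1 v = (U i).1 v := by
    intro i j hij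
    induction j, hij using Nat.le_induction with
    | base => intro v _; rfl
    | succ j hij ih =>
      intro v hv
      rw [hU j v (hSm (by omega) hv), ih v hv]
  have hc' : ∀ v, ∃ j, v ∈ S (k + j) := fun v => by
    obtain ⟨j, hj⟩ := hc v
    exact ⟨j, hSm (by omega) hj⟩
  choose n hn using hc'
  have hw : ∀ j, ∀ v ∈ S (k + j), (U (n v)).1 v = (U j).1 v := by
    intro j v hv
    rcases le_total (n v) j with h | h
    · exact (hU' _ _ h v (hn v)).symm
    · exact hU' _ _ h v hv
  refine ⟨fun v => (U (n v)).1 v, fun v hv => ?_, fun j => ?_⟩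
  · exact hw 0 v hv
  · obtain ⟨f, hf, hfu⟩ := (U j).2 j
    exact ⟨f, hf, fun v hv => by
      have hv' : v ∈ S (k + j) := hSm (by omega) hv
      exact (hfu v hv').trans (hw j v hv').symm⟩

theorem isom_surj [FiniteDimensional ℝ X] (f : X → X) (hf : Isometry f) (h0 : f 0 = 0) :
    Function.Surjective f := by
  have : ProperSpace X := FiniteDimensional.proper ℝ X
  intro y
  by_contra hy
  have hcl : IsClosed (range f) := hf.isClosedEmbedding.isClosed_range
  obtain ⟨ε, hε, hb⟩ := Metric.isOpen_iff.1 hcl.isOpen_compl y hy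
  have hsep : ∀ x, ε ≤ dist (f x) y := by
    intro x
    by_contra hlt
    exact hb (Metric.mem_ball.2 (not_le.1 hlt)) (mem_range_self x)
  have hiso : ∀ n, Isometry (f^[n]) := fun n => by
    induction n with
    | zero => exact isometry_id
    | succ n ih => rw [Function.iterate_succ]; exact ih.comp hf
  have hmem : ∀ n, f^[n] y ∈ Metric.closedBall (0 : X) ‖y‖ := by
    intro n
    have h0n : f^[n] 0 = 0 := Function.iterate_fixed h0 n
    rw [Metric.mem_closedBall]
    conv_lhs => rw [← h0n]
    rw [(hiso n).dist_eq, dist_zero_right]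
  obtain ⟨a, -, φ, hφ, hlim⟩ := (isCompact_closedBall (0 : X) ‖y‖).tendsto_subseq hmem
  have hcau := hlim.cauchySeq
  obtain ⟨N, hN⟩ := Metric.cauchySeq_iff.1 hcau ε hε
  have h1 := hN (N + 1) (by omega) N le_rfl
  have hlt : φ N < φ (N + 1) := hφ (by omega)
  obtain ⟨d, hd⟩ : ∃ d, φ (N + 1) = φ N + (d + 1) := ⟨φ (N + 1) - φ N - 1, by omega⟩
  simp only [Function.comp, hd, Function.iterate_add_apply] at h1
  rw [(hiso _).dist_eq, Function.iterate_one, ← Function.iterate_succ_apply,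
    Function.iterate_succ_apply'] at h1
  exact absurd h1 (not_lt.2 (hsep _))

theorem isom_affine [FiniteDimensional ℝ X] (f : X → X) (hf : Isometry f) :
    ∃ L : X →ₗ[ℝ] X, ∀ x, f x = L x + f 0 := by
  let g : X → X := fun x => f x - f 0
  have hg : Isometry g := Isometry.of_dist_eq fun x y => by
    simp [g, hf.dist_eq]
  have hg0 : g 0 = 0 := by simp [g]
  let e : X ≃ᵢ X := IsometryEquiv.mk (Equiv.ofBijective g ⟨hg.injective, isom_surj g hg hg0⟩) hg
  let l := e.toRealLinearIsometryEquivOfMapZero hg0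
  refine ⟨l.toLinearEquiv.toLinearMap, fun x => ?_⟩
  have : l x = f x - f 0 := rfl
  change f x = l x + f 0
  rw [this]
  abel

theorem motion_affine [FiniteDimensional ℝ X] (γ : X → X) (h : IsInfRigidMotion γ) :
    ∃ L : X × ℝ →ₗ[ℝ] X, ∀ x, γ x = L (x, 1) := by
  obtain ⟨Γ, ⟨hi, -, -⟩, hd⟩ := h
  have hA : ∀ t ∈ Icc (-1 : ℝ) 1, ∃ L : X →ₗ[ℝ] X, ∀ x, Γ x t = L x + Γ 0 t :=
    fun t ht => isom_affine _ (hi t ht)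
  have hud : UniqueDiffWithinAt ℝ (Icc (-1 : ℝ) 1) 0 :=
    uniqueDiffOn_Icc (by norm_num) 0 (by norm_num)
  have hadd : ∀ x y, γ (x + y) + γ 0 = γ x + γ y := by
    intro x y
    refine hud.eq_deriv _ ((hd (x + y)).add (hd 0)) (((hd x).add (hd y)).congr_of_mem ?_ ?_)
    · intro t ht
      obtain ⟨L, hL⟩ := hA t ht
      simp only [Pi.add_apply]
      rw [hL (x + y), hL x, hL y, map_add]
      abel
    · norm_num
  have hsm : ∀ (c : ℝ) x, γ (c • x) - γ 0 = c • (γ x - γ 0) := by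
    intro c x
    refine hud.eq_deriv _ ((hd (c • x)).sub (hd 0))
      ((((hd x).sub (hd 0)).const_smul c).congr_of_mem ?_ ?_)
    · intro t ht
      obtain ⟨L, hL⟩ := hA t ht
      simp only [Pi.sub_apply, Pi.smul_apply]
      rw [hL (c • x), hL x, map_smul]
      simp
    · norm_num
  let M : X →ₗ[ℝ] X :=
    { toFun := fun x => γ x - γ 0
      map_add' := fun x y => by
        have := eq_sub_of_add_eq (hadd x y)
        change γ (x + y) - γ 0 = (γ x - γ 0) + (γ y - γ 0)
        rw [this]
        abel
      map_smul' := fun c x => by simpa using hsm c x }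
  refine ⟨M.coprod (LinearMap.toSpanSingleton ℝ X (γ 0)), fun x => ?_⟩
  simp [M]

theorem tower_mono {G : SimpleGraph V} (T : Tower G) : Monotone T.seq :=
  monotone_nat_of_le_succ T.mono

theorem tower_F {G : SimpleGraph V} (T : Tower G) (p : V → X) :
    Antitone fun k => flexSpace (T.seq k).spanningCoe p := by
  intro a b hab u hu
  exact IsFlex.mono (fun v w h => (tower_mono T hab).2 h) hu

theorem vc {G : SimpleGraph V} {T : Tower G} (h : VertexComplete T) (v : V) :
    ∃ j, v ∈ (T.seq j).verts := by
  have : v ∈ ⋃ k, (T.seq k).verts := by rw [h]; trivial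
  simpa using this

theorem i_to_ii [Countable V] [FiniteDimensional ℝ X] (G : SimpleGraph V) (p : V → X)
    (h : InfRigid G p) : ∃ T : Tower G, VertexComplete T ∧ FlexCancel T p := by
  obtain ⟨e, he⟩ := Countable.exists_injective_nat V
  let S : ℕ → Set V := fun k => e ⁻¹' (Iic k)
  have hSm : Monotone S := fun a b hab => preimage_mono (Iic_subset_Iic.2 hab)
  let T : Tower G :=
    { seq := fun k => (⊤ : G.Subgraph).induce (S k)
      mono := fun k => SimpleGraph.Subgraph.induce_mono_right (hSm (Nat.le_succ k))
      finite := fun k => (finite_Iic k).preimage he.injOn }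
  have hadj : ∀ k v w, (T.seq k).Adj v w ↔ v ∈ S k ∧ w ∈ S k ∧ G.Adj v w := by
    intro k v w
    simp [T]
  have hcov : ∀ v, v ∈ S (e v) := fun v => by simp [S]
  refine ⟨T, ?_, ?_⟩
  · exact eq_univ_of_forall fun v => mem_iUnion.2 ⟨e v, hcov v⟩
  · intro k u hu hnt
    by_contra hcon
    push Not at hcon
    apply hnt
    have hall : ∀ m, ∃ f ∈ flexSpace (T.seq m).spanningCoe p, ∀ v ∈ S k, f v = u v := by
      intro m
      obtain ⟨f, hf, hfu⟩ := hcon (max m (k + 1)) (by omega)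
      exact ⟨f, tower_F T p (le_max_left m (k + 1)) hf, hfu⟩
    obtain ⟨w, hwu, hw⟩ := extend_all _ (tower_F T p) S hSm T.finite k u hall
      (fun v => ⟨e v, hcov v⟩)
    obtain ⟨γ, hγ, hγw⟩ := h w (by
      rw [isFlex_iff]
      intro a b hab
      have ha : a ∈ S (max (e a) (e b)) := hSm (le_max_left _ _) (hcov a)
      have hb : b ∈ S (max (e a) (e b)) := hSm (le_max_right _ _) (hcov b)
      obtain ⟨f, hf, hfw⟩ := hw (max (e a) (e b))
      rw [mem_flexSpace, isFlex_iff] at hf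
      have := hf (v := a) (w := b) ((hadj _ a b).2 ⟨ha, hb, hab⟩)
      rwa [hfw a ha, hfw b hb] at this)
    exact ⟨γ, hγ, fun v hv => by rw [← hwu v hv, hγw v trivial]⟩

theorem ii_to_iii [FiniteDimensional ℝ X] (G : SimpleGraph V) (p : V → X)
    (h : ∃ T : Tower G, VertexComplete T ∧ FlexCancel T p) :
    ∃ T : Tower G, VertexComplete T ∧ RelRigidTower T p := by
  obtain ⟨T, hT, hfc⟩ := h
  have := fun k => stab _ (tower_F T p) (T.seq k).verts (T.finite k) k
  choose N hN hst using this
  let K : ℕ → ℕ := fun j => Nat.rec 0 (fun _ x => N x) j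
  have hK : ∀ j, K (j + 1) = N (K j) := fun j => rfl
  have hlt : ∀ j, K j < K (j + 1) := fun j => hN (K j)
  have hKm : StrictMono K := strictMono_nat_of_lt_succ hlt
  let T' : Tower G :=
    { seq := fun j => T.seq (K j)
      mono := fun j => tower_mono T (hlt j).le
      finite := fun j => T.finite _ }
  refine ⟨T', ?_, ?_⟩
  · refine eq_univ_of_forall fun v => ?_
    obtain ⟨j, hj⟩ := vc hT v
    exact mem_iUnion.2 ⟨j, (tower_mono T (hKm.id_le j)).1 hj⟩
  · intro j u hu hex
    by_contra hnt
    obtain ⟨m, -, hm⟩ := hfc (K j) u hu hnt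
    exact hm (hst (K j) u hex m)

theorem iii_to_ii (G : SimpleGraph V) (p : V → X)
    (h : ∃ T : Tower G, VertexComplete T ∧ RelRigidTower T p) :
    ∃ T : Tower G, VertexComplete T ∧ FlexCancel T p := by
  obtain ⟨T, hT, hr⟩ := h
  exact ⟨T, hT, fun k u hu hnt => ⟨k + 1, by omega, fun hex => hnt (hr k u hu hex)⟩⟩

theorem iii_to_i [FiniteDimensional ℝ X] (G : SimpleGraph V) (p : V → X)
    (h : ∃ T : Tower G, VertexComplete T ∧ RelRigidTower T p) : InfRigid G p := by
  obtain ⟨T, hT, hr⟩ := h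
  intro u hu
  have hfl : ∀ k, IsFlex (T.seq k).spanningCoe p u := fun k =>
    IsFlex.mono (fun v w hvw => (T.seq k).adj_sub hvw) hu
  have htr : ∀ k, IsTrivialOn p (T.seq k).verts u := fun k =>
    hr k u (hfl k) ⟨u, hfl (k + 1), fun _ _ => rfl⟩
  choose γ hγ hγu using htr
  choose L hL using fun k => motion_affine (γ k) (hγ k)
  let q : V → X × ℝ := fun v => (p v, 1)
  let W : ℕ →o Submodule ℝ (X × ℝ) :=
    ⟨fun k => Submodule.span ℝ (q '' (T.seq k).verts),
      fun a b hab => Submodule.span_mono (image_mono (tower_mono T hab).1)⟩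
  obtain ⟨n, hn⟩ := monotone_stabilizes_iff_noetherian.2 (inferInstance : IsNoetherian ℝ (X × ℝ)) W
  refine ⟨γ n, hγ n, fun v _ => ?_⟩
  obtain ⟨j, hj⟩ := vc hT v
  let m := max n j
  have hv : v ∈ (T.seq m).verts := (tower_mono T (le_max_right n j)).1 hj
  have heq : EqOn (L n) (L m) (q '' (T.seq n).verts) := by
    rintro _ ⟨x, hx, rfl⟩
    have h1 := hγu n x hx
    have h2 := hγu m x ((tower_mono T (le_max_left n j)).1 hx)
    rw [hL] at h1 h2
    exact h1.symm.trans h2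
  have hmem : q v ∈ Submodule.span ℝ (q '' (T.seq n).verts) := by
    have : W n = W m := hn m (le_max_left n j)
    change q v ∈ W n
    rw [this]
    exact Submodule.subset_span (mem_image_of_mem q hv)
  have h3 := LinearMap.eqOn_span heq hmem
  rw [hγu m v hv, hL, hL]
  exact h3.symm

end Aux

theorem statement_0 {V X : Type} [Countable V] [NormedAddCommGroup X] [NormedSpace ℝ X]
    [FiniteDimensional ℝ X] (G : SimpleGraph V) (p : V → X) (hp : IsPlacement G p) :
    (InfRigid G p ↔ ∃ T : Tower G, VertexComplete T ∧ FlexCancel T p) ∧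
    (InfRigid G p ↔ ∃ T : Tower G, VertexComplete T ∧ RelRigidTower T p) := by
  exact ⟨⟨i_to_ii G p, fun h => iii_to_i G p (ii_to_iii G p h)⟩,
    ⟨fun h => ii_to_iii G p (i_to_ii G p h), iii_to_i G p⟩⟩

end RigidityPaper
end
end

section
/- Let G be a countable simple graph and let q ∈ (1,∞). Then G is rigid in (ℝ²,‖·‖_q) if and only if G is sequentially rigid in (ℝ²,‖·‖_q). -/
open Asymptotics Filter Topology Set

open scoped Classical

noncomputable section

namespace RigidityPaper

variable {V X E : Type}

variable {G : SimpleGraph V}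

/-! ### Scalar facts -/

def co (q x : ℝ) : ℝ := Real.sign x * |x| ^ (q - 1)

lemma co_mul (q x y : ℝ) : co q (x * y) = co q x * co q y := by
  have hs : Real.sign (x * y) = Real.sign x * Real.sign y := by
    rcases lt_trichotomy x 0 with hx | hx | hx <;> rcases lt_trichotomy y 0 with hy | hy | hy <;>
      simp [Real.sign_of_neg, Real.sign_of_pos, hx, hy, mul_pos_of_neg_of_neg, mul_neg_of_neg_of_pos,
        mul_neg_of_pos_of_neg]
  unfold co
  rw [hs, abs_mul, Real.mul_rpow (abs_nonneg _) (abs_nonneg _)]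
  ring

lemma co_neg (q x : ℝ) : co q (-x) = - co q x := by
  unfold co
  rw [Real.sign_neg, abs_neg]; ring

lemma co_zero (q : ℝ) : co q 0 = 0 := by simp [co]

lemma co_pos {q x : ℝ} (hx : 0 < x) : co q x = x ^ (q - 1) := by
  simp [co, Real.sign_of_pos hx, abs_of_pos hx]

lemma co_one (q : ℝ) : co q 1 = 1 := by rw [co_pos one_pos]; simp

lemma co_eq (q x : ℝ) : co q x = |x| ^ (q - 2) * x := by
  rcases eq_or_ne x 0 with rfl | hx
  · simp [co]
  · have h : |x| ^ (q - 1) = |x| ^ (q - 2) * |x| := by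
      rw [show q - 1 = (q - 2) + 1 by ring, Real.rpow_add_one (abs_ne_zero.2 hx)]
    unfold co
    rw [h]
    rcases lt_or_gt_of_ne hx with hx | hx
    · rw [Real.sign_of_neg hx, abs_of_neg hx]; ring
    · rw [Real.sign_of_pos hx, abs_of_pos hx]; ring

lemma co_ne_zero {q x : ℝ} (hx : x ≠ 0) : co q x ≠ 0 := by
  rw [co_eq]
  exact mul_ne_zero (Real.rpow_pos_of_pos (abs_pos.2 hx) _).ne' hx

lemma co_eq_zero {q x : ℝ} : co q x = 0 ↔ x = 0 :=
  ⟨fun h => by_contra fun hx => co_ne_zero hx h, fun h => by rw [h, co_zero]⟩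

lemma co_inj {q : ℝ} (hq : 1 < q) {x y : ℝ} (h : co q x = co q y) : x = y := by
  have hq' : q - 1 ≠ 0 := by linarith
  have key : ∀ {a b : ℝ}, 0 < a → 0 < b → co q a = co q b → a = b := by
    intro a b ha hb h
    rw [co_pos ha, co_pos hb] at h
    exact (Real.rpow_left_inj ha.le hb.le hq').1 h
  have pos : ∀ {a : ℝ}, 0 < a → 0 < co q a := fun ha => by
    rw [co_pos ha]; exact Real.rpow_pos_of_pos ha _
  rcases lt_trichotomy x 0 with hx | hx | hx <;> rcases lt_trichotomy y 0 with hy | hy | hy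
  · have := key (neg_pos.2 hx) (neg_pos.2 hy) (by rw [co_neg, co_neg, h])
    linarith
  · rw [hy, co_zero, co_eq_zero] at h; linarith
  · have h1 := pos (neg_pos.2 hx); rw [co_neg] at h1
    have h2 := pos hy; linarith
  · rw [hx, co_zero] at h
    rw [hx, eq_comm, ← co_eq_zero (q := q), h]
  · rw [hx, hy]
  · rw [hx, co_zero] at h
    rw [hx, eq_comm, ← co_eq_zero (q := q), h]
  · have h1 := pos (neg_pos.2 hy); rw [co_neg] at h1
    have h2 := pos hx; linarith
  · rw [hy, co_zero, co_eq_zero] at h; linarith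
  · exact key hx hy h

lemma co_two (x : ℝ) : co 2 x = x := by
  rw [co_eq]; simp

lemma co_det {q : ℝ} (hq : 1 < q) {a b c d : ℝ} (h : a * d - b * c ≠ 0) :
    co q a * co q d - co q b * co q c ≠ 0 := by
  intro h'
  rw [← co_mul, ← co_mul, sub_eq_zero] at h'
  exact h (sub_eq_zero.2 (co_inj hq h'))

lemma co_continuous {q : ℝ} (hq : 1 < q) : Continuous (co q) := by
  have : co q = fun x => deriv (fun x : ℝ => |x| ^ q) x / q := by
    ext x
    rw [(hasDerivAt_abs_rpow x hq).deriv, co_eq]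
    field_simp
  rw [continuous_iff_continuousAt]
  intro x
  rcases eq_or_ne x 0 with rfl | hx
  · rw [ContinuousAt, co_zero]
    apply squeeze_zero_norm (a := fun x : ℝ => |x| ^ (q - 1))
    · intro t
      unfold co
      rw [norm_mul, Real.norm_eq_abs, Real.norm_eq_abs, abs_of_nonneg (a := |t| ^ (q - 1)) (by positivity)]
      have : |Real.sign t| ≤ 1 := by
        rcases Real.sign_apply_eq t with h | h | h <;> rw [h] <;> simp
      nlinarith [Real.rpow_nonneg (abs_nonneg t) (q - 1)]
    · have : Continuous fun x : ℝ => |x| ^ (q - 1) :=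
        continuous_abs.rpow_const (fun x => Or.inr (by linarith))
      have h0 := this.tendsto 0
      rwa [abs_zero, Real.zero_rpow (by linarith)] at h0
  · have : co q = fun x => |x| ^ (q - 2) * x := funext (co_eq q)
    rw [this]
    exact (continuousAt_id.abs.rpow_const (Or.inl (abs_ne_zero.2 hx))).mul continuousAt_id

/-! ### Derivative of the norm, flexes as linear conditions -/

lemma qnorm_hasDerivAt {q : ℝ} (hq : 1 < q) (x : Fin 2 → ℝ) (hx : x ≠ 0) :
    ∃ K : ℝ, K ≠ 0 ∧ ∀ (f : ℝ → Fin 2 → ℝ) (h : Fin 2 → ℝ), f 0 = x → HasDerivAt f h 0 →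
      HasDerivAt (fun t => qnorm q (f t)) (K * (co q (x 0) * h 0 + co q (x 1) * h 1)) 0 := by
  set A : ℝ := |x 0| ^ q + |x 1| ^ q with hA
  have hApos : 0 < A := by
    by_cases h0 : x 0 = 0
    · have h1 : x 1 ≠ 0 := by
        intro h1; apply hx; ext i; fin_cases i <;> simp [h0, h1]
      have := Real.rpow_pos_of_pos (abs_pos.2 h1) q
      have := Real.rpow_nonneg (abs_nonneg (x 0)) q
      linarith
    · have := Real.rpow_pos_of_pos (abs_pos.2 h0) q
      have := Real.rpow_nonneg (abs_nonneg (x 1)) q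
      linarith
  refine ⟨A ^ (1 / q - 1), (Real.rpow_pos_of_pos hApos _).ne', ?_⟩
  intro f h hf hd
  have hd' := hasDerivAt_pi.1 hd
  have e : ∀ i, HasDerivAt (fun t => |f t i| ^ q) (q * |x i| ^ (q - 2) * x i * h i) 0 := by
    intro i
    have h1 : HasDerivAt (fun x : ℝ => |x| ^ q) (q * |x i| ^ (q - 2) * x i) (f 0 i) := by
      rw [hf]; exact hasDerivAt_abs_rpow (x i) hq
    exact h1.comp 0 (hd' i)
  have h2 : HasDerivAt (fun t => |f t 0| ^ q + |f t 1| ^ q)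
      (q * |x 0| ^ (q - 2) * x 0 * h 0 + q * |x 1| ^ (q - 2) * x 1 * h 1) 0 := (e 0).add (e 1)
  have h3 := h2.rpow_const (p := 1 / q) (Or.inl (by simp [hf, ← hA, hApos.ne']))
  have : (fun t => qnorm q (f t)) = fun t => (|f t 0| ^ q + |f t 1| ^ q) ^ (1 / q) := by
    ext t; simp [qnorm, Fin.sum_univ_two]
  rw [this]
  refine h3.congr_deriv ?_
  rw [hf, ← hA, co_eq, co_eq]
  field_simp

/-- The pairing of a velocity field with the row of the pair `v w`. -/
def pr (q : ℝ) (p u : V → Fin 2 → ℝ) (v w : V) : ℝ :=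
  co q (p v 0 - p w 0) * (u v 0 - u w 0) + co q (p v 1 - p w 1) * (u v 1 - u w 1)

lemma pr_symm (q : ℝ) (p u : V → Fin 2 → ℝ) (v w : V) : pr q p u v w = pr q p u w v := by
  unfold pr
  rw [← neg_sub (p w 0), ← neg_sub (p w 1), co_neg, co_neg]; ring

lemma flex_iff {q : ℝ} (hq : 1 < q) (p u : V → Fin 2 → ℝ) {v w : V} (h : p v ≠ p w) :
    ((fun t : ℝ => qnorm q ((p v + t • u v) - (p w + t • u w)) - qnorm q (p v - p w))
      =o[𝓝 (0 : ℝ)] (fun t : ℝ => t)) ↔ pr q p u v w = 0 := by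
  obtain ⟨K, hK, H⟩ := qnorm_hasDerivAt hq (p v - p w) (sub_ne_zero.2 h)
  have hd : HasDerivAt (fun t : ℝ => (p v + t • u v) - (p w + t • u w)) (u v - u w) 0 := by
    have h1 : ∀ a b : Fin 2 → ℝ, HasDerivAt (fun t : ℝ => a + t • b) b 0 := by
      intro a b
      simpa using ((hasDerivAt_id (0 : ℝ)).smul_const b).const_add a
    exact (h1 _ _).sub (h1 _ _)
  have hD := H _ _ (by simp) hd
  have hz : ((fun t : ℝ => qnorm q ((p v + t • u v) - (p w + t • u w)) - qnorm q (p v - p w))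
      =o[𝓝 (0 : ℝ)] (fun t : ℝ => t)) ↔
      HasDerivAt (fun t : ℝ => qnorm q ((p v + t • u v) - (p w + t • u w))) 0 0 := by
    rw [hasDerivAt_iff_isLittleO]; simp
  rw [hz]
  simp only [Pi.sub_apply] at hD
  constructor
  · intro h0
    have := hD.unique h0
    exact (mul_eq_zero.1 this).resolve_left hK
  · intro h0
    unfold pr at h0
    rwa [h0, mul_zero] at hD

lemma motion_pr {q : ℝ} (hq : 1 < q) {γ : (Fin 2 → ℝ) → Fin 2 → ℝ} (hγ : IsQInfRigidMotion q γ)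
    (p : V → Fin 2 → ℝ) {v w : V} (h : p v ≠ p w) : pr q p (fun z => γ (p z)) v w = 0 := by
  obtain ⟨Γ, ⟨h1, -, h3⟩, h4⟩ := hγ
  obtain ⟨K, hK, H⟩ := qnorm_hasDerivAt hq (p v - p w) (sub_ne_zero.2 h)
  have hn : Icc (-1 : ℝ) 1 ∈ 𝓝 (0 : ℝ) := Icc_mem_nhds (by norm_num) (by norm_num)
  have hd := ((h4 (p v)).hasDerivAt hn).sub ((h4 (p w)).hasDerivAt hn)
  have hD := H (fun t => Γ (p v) t - Γ (p w) t) _ (by simp [h3]) hd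
  have hc : HasDerivAt (fun t => qnorm q (Γ (p v) t - Γ (p w) t)) 0 0 := by
    apply (hasDerivAt_const (0 : ℝ) (qnorm q (p v - p w))).congr_of_eventuallyEq
    filter_upwards [hn] with t ht
    exact h1 t ht _ _
  have := hD.unique hc
  exact (mul_eq_zero.1 this).resolve_left hK

/-- The standard infinitesimal motions. -/
def mot (a b c : ℝ) (x : Fin 2 → ℝ) : Fin 2 → ℝ := ![b - a * x 1, c + a * x 0]

lemma mot_isMotion {q : ℝ} {a b c : ℝ} (ha : q ≠ 2 → a = 0) : IsQInfRigidMotion q (mot a b c) := by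
  refine ⟨fun x t => ![x 0 * Real.cos (a * t) - x 1 * Real.sin (a * t) + t * b,
    x 0 * Real.sin (a * t) + x 1 * Real.cos (a * t) + t * c], ⟨?_, ?_, ?_⟩, ?_⟩
  · intro t _ x y
    by_cases hq : q = 2
    · subst hq
      simp only [qnorm, Fin.sum_univ_two, Pi.sub_apply, Matrix.cons_val_zero, Matrix.cons_val_one]
      congr 1
      simp only [Real.rpow_two, sq_abs]
      linear_combination ((x 0 - y 0) ^ 2 + (x 1 - y 1) ^ 2) * Real.sin_sq_add_cos_sq (a * t)
    · rw [ha hq]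
      simp [qnorm, Fin.sum_univ_two]
  · intro x
    apply Continuous.continuousOn
    rw [continuous_pi_iff]
    intro i
    fin_cases i <;> simp <;> fun_prop
  · intro x
    ext i
    fin_cases i <;> simp
  · intro x
    apply HasDerivAt.hasDerivWithinAt
    rw [hasDerivAt_pi]
    have hm : HasDerivAt (fun t : ℝ => a * t) a 0 := by simpa using (hasDerivAt_id (0 : ℝ)).const_mul a
    have hs : HasDerivAt (fun t : ℝ => Real.sin (a * t)) a 0 := by simpa using hm.sin
    have hc : HasDerivAt (fun t : ℝ => Real.cos (a * t)) 0 0 := by simpa using hm.cos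
    have hl : ∀ b : ℝ, HasDerivAt (fun t : ℝ => t * b) b 0 := fun b => by
      simpa using (hasDerivAt_id (0 : ℝ)).mul_const b
    intro i
    fin_cases i
    · have := ((hc.const_mul (x 0)).sub (hs.const_mul (x 1))).add (hl b)
      refine HasDerivAt.congr_deriv (f := fun t => _) this ?_
      simp [mot]; ring
    · have := ((hs.const_mul (x 0)).add (hc.const_mul (x 1))).add (hl c)
      refine HasDerivAt.congr_deriv (f := fun t => _) this ?_
      simp [mot]; ring

/-! ### Rows indexed by unordered pairs -/

lemma rigidityRow_symm (q : ℝ) (p : V → Fin 2 → ℝ) (v w : V) :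
    rigidityRow q p v w = rigidityRow q p w v := by
  funext x
  have h : rigidityCoef q (p w x.2) (p v x.2) = - rigidityCoef q (p v x.2) (p w x.2) := by
    change co q _ = - co q _
    rw [← co_neg, neg_sub]
  unfold rigidityRow
  rw [h]
  split_ifs <;> ring

def row (q : ℝ) (p : V → Fin 2 → ℝ) : Sym2 V → V × Fin 2 → ℝ :=
  Sym2.lift ⟨rigidityRow q p, rigidityRow_symm q p⟩

lemma row_mk (q : ℝ) (p : V → Fin 2 → ℝ) (v w : V) : row q p s(v, w) = rigidityRow q p v w := rfl

lemma row_apply (q : ℝ) (p : V → Fin 2 → ℝ) (v w x : V) (i : Fin 2) :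
    row q p s(v, w) (x, i) = (if x = v then co q (p v i - p w i) else 0) -
      (if x = w then co q (p v i - p w i) else 0) := rfl

lemma row_of_notMem (q : ℝ) (p : V → Fin 2 → ℝ) {e : Sym2 V} {v : V} (h : v ∉ e) (i : Fin 2) :
    row q p e (v, i) = 0 := by
  induction e using Sym2.ind with
  | _ a b =>
    rw [Sym2.mem_iff, not_or] at h
    rw [row_apply, if_neg h.1, if_neg h.2, sub_zero]

lemma row_self (q : ℝ) (p : V → Fin 2 → ℝ) {v a : V} (h : v ≠ a) (i : Fin 2) :
    row q p s(v, a) (v, i) = co q (p v i - p a i) := by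
  rw [row_apply, if_pos rfl, if_neg h, sub_zero]

def Ind (q : ℝ) (p : V → Fin 2 → ℝ) (F : Finset (Sym2 V)) : Prop :=
  LinearIndepOn ℝ (row q p) (F : Set (Sym2 V))

lemma ind_iff {q : ℝ} {p : V → Fin 2 → ℝ} {F : Finset (Sym2 V)} :
    Ind q p F ↔ ∀ f : Sym2 V → ℝ, ∑ e ∈ F, f e • row q p e = 0 → ∀ e ∈ F, f e = 0 :=
  linearIndepOn_finset_iff

lemma Ind.mono {q : ℝ} {p : V → Fin 2 → ℝ} {F F' : Finset (Sym2 V)} (h : Ind q p F')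
    (hF : F ⊆ F') : Ind q p F := LinearIndepOn.mono h (by exact_mod_cast hF)

def det3 (p : V → Fin 2 → ℝ) (v a c : V) : ℝ :=
  (p v 0 - p a 0) * (p v 1 - p c 1) - (p v 1 - p a 1) * (p v 0 - p c 0)

def GP (p : V → Fin 2 → ℝ) : Prop :=
  (∀ a b, a ≠ b → p a ≠ p b) ∧ ∀ v a c, v ≠ a → v ≠ c → a ≠ c → det3 p v a c ≠ 0

lemma sum_row_v {q : ℝ} {p : V → Fin 2 → ℝ} {F : Finset (Sym2 V)} {v : V}
    (hv : ∀ e ∈ F, v ∉ e) (f : Sym2 V → ℝ) (i : Fin 2) :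
    (∑ e ∈ F, f e • row q p e) (v, i) = 0 := by
  rw [Finset.sum_apply]
  apply Finset.sum_eq_zero
  intro e he
  rw [Pi.smul_apply, row_of_notMem q p (hv e he), smul_zero]

/-- 0-extension with one edge. -/
lemma ext_one {q : ℝ} {p : V → Fin 2 → ℝ} {F : Finset (Sym2 V)} {v a : V}
    (hv : ∀ e ∈ F, v ∉ e) (hva : v ≠ a) (hp : p v ≠ p a) (h : Ind q p F) :
    Ind q p (insert s(v, a) F) := by
  rw [ind_iff] at h ⊢
  intro f hf
  have hn : s(v, a) ∉ F := fun h' => hv _ h' (Sym2.mem_mk_left _ _)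
  rw [Finset.sum_insert hn] at hf
  have key : f s(v, a) = 0 := by
    by_contra hne
    apply hp
    funext i
    have := congrFun hf (v, i)
    rw [Pi.add_apply, sum_row_v hv, Pi.smul_apply, row_self q p hva, smul_eq_mul, Pi.zero_apply,
      add_zero] at this
    exact sub_eq_zero.1 (co_eq_zero.1 ((mul_eq_zero.1 this).resolve_left hne))
  rw [key, zero_smul, zero_add] at hf
  intro e he
  rcases Finset.mem_insert.1 he with rfl | he
  · exact key
  · exact h f hf e he

/-- 0-extension with two edges. -/
lemma ext_two {q : ℝ} (hq : 1 < q) {p : V → Fin 2 → ℝ} {F : Finset (Sym2 V)} {v a c : V}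
    (hv : ∀ e ∈ F, v ∉ e) (hva : v ≠ a) (hvc : v ≠ c) (hac : a ≠ c) (hp : det3 p v a c ≠ 0)
    (h : Ind q p F) : Ind q p (insert s(v, a) (insert s(v, c) F)) := by
  rw [ind_iff] at h ⊢
  intro f hf
  have hn : s(v, c) ∉ F := fun h' => hv _ h' (Sym2.mem_mk_left _ _)
  have hn' : s(v, a) ∉ insert s(v, c) F := by
    rw [Finset.mem_insert, not_or]
    refine ⟨?_, fun h' => hv _ h' (Sym2.mem_mk_left _ _)⟩
    rw [Sym2.congr_right]
    exact hac
  rw [Finset.sum_insert hn', Finset.sum_insert hn] at hf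
  have E : ∀ i, f s(v, a) * co q (p v i - p a i) + f s(v, c) * co q (p v i - p c i) = 0 := by
    intro i
    have := congrFun hf (v, i)
    rwa [Pi.add_apply, Pi.add_apply, sum_row_v hv, Pi.smul_apply, Pi.smul_apply, row_self q p hva,
      row_self q p hvc, smul_eq_mul, smul_eq_mul, Pi.zero_apply, add_zero] at this
  have hd := co_det hq hp
  have ka : f s(v, a) = 0 := by
    apply (mul_eq_zero.1 (_ : f s(v, a) * (co q (p v 0 - p a 0) * co q (p v 1 - p c 1) -
      co q (p v 1 - p a 1) * co q (p v 0 - p c 0)) = 0)).resolve_right hd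
    linear_combination co q (p v 1 - p c 1) * E 0 - co q (p v 0 - p c 0) * E 1
  have kc : f s(v, c) = 0 := by
    apply (mul_eq_zero.1 (_ : f s(v, c) * (co q (p v 0 - p a 0) * co q (p v 1 - p c 1) -
      co q (p v 1 - p a 1) * co q (p v 0 - p c 0)) = 0)).resolve_right hd
    linear_combination co q (p v 0 - p a 0) * E 1 - co q (p v 1 - p a 1) * E 0
  rw [ka, kc, zero_smul, zero_smul, zero_add, zero_add] at hf
  intro e he
  rcases Finset.mem_insert.1 he with rfl | he
  · exact ka
  rcases Finset.mem_insert.1 he with rfl | he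
  · exact kc
  · exact h f hf e he

lemma row_congr {q : ℝ} {p p' : V → Fin 2 → ℝ} {e : Sym2 V} (h : ∀ v ∈ e, p v = p' v) :
    row q p e = row q p' e := by
  induction e using Sym2.ind with
  | _ a b =>
    funext x
    have ha := h a (Sym2.mem_mk_left _ _)
    have hb := h b (Sym2.mem_mk_right _ _)
    rw [show x = (x.1, x.2) from rfl, row_apply, row_apply, ha, hb]

lemma Ind.congr {q : ℝ} {p p' : V → Fin 2 → ℝ} {F : Finset (Sym2 V)}
    (h : ∀ e ∈ F, ∀ v ∈ e, p v = p' v) (hi : Ind q p F) : Ind q p' F := by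
  refine LinearIndepOn.congr hi ?_
  intro e he
  exact row_congr (h e he)

/-- 1-extension. -/
lemma ext_edge {q : ℝ} (hq : 1 < q) {p : V → Fin 2 → ℝ} {F : Finset (Sym2 V)} {v a b c : V}
    (hv : ∀ e ∈ F, v ∉ e) (hva : v ≠ a) (hvb : v ≠ b) (hvc : v ≠ c) (hab : a ≠ b) (hac : a ≠ c)
    (hbc : b ≠ c) (hF : s(a, b) ∉ F) (hp : GP p) (h : Ind q p (insert s(a, b) F)) :
    ∃ p', Ind q p' (insert s(v, a) (insert s(v, b) (insert s(v, c) F))) := by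
  set m : Fin 2 → ℝ := fun i => (p a i + p b i) / 2 with hm
  set p' := Function.update p v m with hp'
  have pv : p' v = m := Function.update_self ..
  have pa : p' a = p a := Function.update_of_ne hva.symm ..
  have pb : p' b = p b := Function.update_of_ne hvb.symm ..
  have pc : p' c = p c := Function.update_of_ne hvc.symm ..
  have hv' : ∀ e ∈ insert s(a, b) F, v ∉ e := by
    intro e he
    rcases Finset.mem_insert.1 he with rfl | he
    · rw [Sym2.mem_iff, not_or]; exact ⟨hva, hvb⟩
    · exact hv e he
  have h1 : Ind q p' (insert s(a, b) F) := by
    refine h.congr ?_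
    intro e he x hx
    have : x ≠ v := by rintro rfl; exact hv' e he hx
    exact (Function.update_of_ne this ..).symm
  have hd : det3 p' v a c ≠ 0 := by
    have h0 := hp.2 b a c hab.symm hbc hac
    intro h1
    apply h0
    unfold det3 at h1 ⊢
    rw [pv, pa, pc] at h1
    simp only [hm] at h1
    linear_combination 2 * h1
  have h2 := ext_two hq hv' hva hvc hac hd h1
  have hrel : row q p' s(v, b) = co q (1 / 2) • row q p' s(a, b) - row q p' s(v, a) := by
    funext ⟨x, i⟩
    rw [Pi.sub_apply, Pi.smul_apply, row_apply, row_apply, row_apply, pa, pb, pv]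
    have e1 : co q (m i - p b i) = co q (1 / 2) * co q (p a i - p b i) := by
      rw [← co_mul]; congr 1; simp only [hm]; ring
    have e2 : co q (m i - p a i) = - (co q (1 / 2) * co q (p a i - p b i)) := by
      rw [← co_mul, ← co_neg]; congr 1; simp only [hm]; ring
    rw [e1, e2, smul_eq_mul]
    split_ifs <;> ring
  refine ⟨p', ?_⟩
  rw [ind_iff] at h2 ⊢
  intro f hf
  have nva : ∀ x, s(v, x) ∉ F := fun x h' => hv _ h' (Sym2.mem_mk_left _ _)
  have nab : s(v, a) ≠ s(v, b) := by rw [Ne, Sym2.congr_right]; exact hab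
  have nac : s(v, a) ≠ s(v, c) := by rw [Ne, Sym2.congr_right]; exact hac
  have nbc : s(v, b) ≠ s(v, c) := by rw [Ne, Sym2.congr_right]; exact hbc
  have nx : ∀ x, s(v, x) ≠ s(a, b) := by
    intro x hx
    have : v ∈ s(a, b) := hx ▸ Sym2.mem_mk_left v x
    rw [Sym2.mem_iff] at this
    tauto
  rw [Finset.sum_insert (by simp only [Finset.mem_insert, not_or]; exact ⟨nab, nac, nva a⟩),
    Finset.sum_insert (by simp only [Finset.mem_insert, not_or]; exact ⟨nbc, nva b⟩),
    Finset.sum_insert (nva c), hrel] at hf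
  set g : Sym2 V → ℝ := fun e => if e = s(v, a) then f s(v, a) - f s(v, b) else
    if e = s(a, b) then f s(v, b) * co q (1 / 2) else f e with hg
  have ga : g s(v, a) = f s(v, a) - f s(v, b) := if_pos rfl
  have gb : g s(a, b) = f s(v, b) * co q (1 / 2) := by
    simp only [hg]; rw [if_neg (nx a).symm]; simp
  have gc : g s(v, c) = f s(v, c) := by
    simp only [hg]; rw [if_neg nac.symm, if_neg (nx c)]
  have gF : ∀ e ∈ F, g e = f e := by
    intro e he
    simp only [hg]
    rw [if_neg (by rintro rfl; exact nva a he), if_neg (by rintro rfl; exact hF he)]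
  have hg0 := h2 g (by
    rw [Finset.sum_insert (by simp only [Finset.mem_insert, not_or]; exact ⟨nac, nx a, nva a⟩),
      Finset.sum_insert (by simp only [Finset.mem_insert, not_or]; exact ⟨nx c, nva c⟩),
      Finset.sum_insert hF, ga, gb, gc, Finset.sum_congr rfl (fun e he => by rw [gF e he]), ← hf]
    module)
  have k1 := hg0 s(v, a) (by simp)
  have k2 := hg0 s(a, b) (by simp)
  have k3 := hg0 s(v, c) (by simp)
  rw [ga] at k1; rw [gb] at k2; rw [gc] at k3
  have k4 : f s(v, b) = 0 := (mul_eq_zero.1 k2).resolve_right (co_ne_zero (by norm_num))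
  intro e he
  simp only [Finset.mem_insert] at he
  rcases he with rfl | rfl | rfl | he
  · linarith
  · exact k4
  · exact k3
  · rw [← gF e he]; exact hg0 e (by simp [he])

/-! ### Openness -/

lemma row_continuous {q : ℝ} (hq : 1 < q) (e : Sym2 V) :
    Continuous (fun p : V → Fin 2 → ℝ => row q p e) := by
  induction e using Sym2.ind with
  | _ a b =>
    rw [continuous_pi_iff]
    rintro ⟨x, i⟩
    simp only [row_apply]
    have h : Continuous fun p : V → Fin 2 → ℝ => co q (p a i - p b i) :=
      (co_continuous hq).comp (by fun_prop)
    split_ifs <;> fun_prop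

lemma eventually_indep [Fintype V] {F : Finset (Sym2 V)} {R : ℝ → Sym2 V → V × Fin 2 → ℝ}
    (hc : ∀ e ∈ F, Continuous (fun t => R t e))
    (h0 : LinearIndepOn ℝ (R 0) (F : Set (Sym2 V))) :
    ∀ᶠ t in 𝓝 0, LinearIndepOn ℝ (R t) (F : Set (Sym2 V)) := by
  have ho : IsOpen {f : ↥(F : Set (Sym2 V)) → V × Fin 2 → ℝ | LinearIndependent ℝ f} :=
    isOpen_setOfPred_linearIndependent
  have hcont : Continuous fun t => fun e : ↥(F : Set (Sym2 V)) => R t e := by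
    rw [continuous_pi_iff]
    intro e
    exact hc e e.2
  have hm : (fun e : ↥(F : Set (Sym2 V)) => R 0 e) ∈
      {f : ↥(F : Set (Sym2 V)) → V × Fin 2 → ℝ | LinearIndependent ℝ f} := by
    simp only [mem_ofPred_eq]; exact h0
  have hca : Tendsto (fun t => fun e : ↥(F : Set (Sym2 V)) => R t e) (𝓝 0) (𝓝 fun e => R 0 e) :=
    hcont.tendsto 0
  filter_upwards [hca.eventually (ho.eventually_mem hm)] with t ht
  exact ht

lemma quad_ne {a b c : ℝ} (h : c ≠ 0) : ∀ᶠ t in 𝓝[≠] (0 : ℝ), a + b * t + c * t ^ 2 ≠ 0 := by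
  have hfin : {t : ℝ | a + b * t + c * t ^ 2 = 0}.Finite := by
    set P : Polynomial ℝ := Polynomial.C a + Polynomial.C b * Polynomial.X +
      Polynomial.C c * Polynomial.X ^ 2 with hP
    have hP0 : P ≠ 0 := by
      intro h0
      apply h
      have := congrArg (fun Q => Polynomial.coeff Q 2) h0
      simpa [hP, Polynomial.coeff_X, Polynomial.coeff_C] using this
    refine (P.roots.toFinset.finite_toSet).subset ?_
    intro t ht
    simp only [Finset.mem_coe, Multiset.mem_toFinset, Polynomial.mem_roots hP0, Polynomial.IsRoot]
    simpa [hP] using ht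
  have := hfin.isClosed.isOpen_compl
  by_cases h0 : (0 : ℝ) ∈ {t : ℝ | a + b * t + c * t ^ 2 = 0}
  · have h1 := (hfin.subset (sdiff_subset (t := {0}))).isClosed.isOpen_compl
    have h2 := h1.mem_nhds (x := 0) (by simp)
    filter_upwards [nhdsWithin_le_nhds h2, self_mem_nhdsWithin] with t ht ht'
    intro h3
    exact ht ⟨h3, ht'⟩
  · filter_upwards [nhdsWithin_le_nhds (this.mem_nhds h0)] with t ht
    exact ht

lemma exists_gp [Fintype V] {q : ℝ} (hq : 1 < q) {p : V → Fin 2 → ℝ} {F : Finset (Sym2 V)}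
    (h : Ind q p F) : ∃ p', GP p' ∧ Ind q p' F := by
  set n : V → ℝ := fun v => ((Fintype.equivFin V v : ℕ) : ℝ) with hn
  have ninj : ∀ a b, a ≠ b → n a - n b ≠ 0 := by
    intro a b hab h
    apply hab
    have : (Fintype.equivFin V a : ℕ) = (Fintype.equivFin V b : ℕ) := by
      have := sub_eq_zero.1 h
      simp only [hn] at this
      exact_mod_cast this
    exact (Fintype.equivFin V).injective (Fin.ext this)
  set P : ℝ → V → Fin 2 → ℝ := fun t v => ![p v 0 + t * n v, p v 1 + t * n v ^ 2] with hP
  have P0 : P 0 = p := by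
    funext v i
    fin_cases i <;> simp [hP]
  have hPc : Continuous P := by
    rw [continuous_pi_iff]; intro v
    rw [continuous_pi_iff]; intro i
    fin_cases i <;> simp [hP] <;> fun_prop
  have e1 : ∀ᶠ t in 𝓝 0, LinearIndepOn ℝ (row q (P t)) (F : Set (Sym2 V)) :=
    eventually_indep (R := fun t => row q (P t)) (fun e _ => (row_continuous hq e).comp hPc)
      (by rw [P0]; exact h)
  have e2 : ∀ᶠ t in 𝓝[≠] (0 : ℝ), ∀ a b, a ≠ b → P t a ≠ P t b := by
    rw [eventually_all]; intro a
    rw [eventually_all]; intro b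
    by_cases hab : a = b
    · simp [hab]
    have := quad_ne (a := 0) (b := p a 0 - p b 0) (ninj a b hab)
    filter_upwards [this] with t ht _ h'
    apply ht
    have h0 := congrFun h' 0
    simp [hP] at h0
    linear_combination t * h0
  have e3 : ∀ᶠ t in 𝓝[≠] (0 : ℝ), ∀ v a c, v ≠ a → v ≠ c → a ≠ c → det3 (P t) v a c ≠ 0 := by
    rw [eventually_all]; intro v
    rw [eventually_all]; intro a
    rw [eventually_all]; intro c
    by_cases hva : v = a
    · simp [hva]
    by_cases hvc : v = c
    · simp [hvc]
    by_cases hac : a = c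
    · simp [hac]
    have hD : (n v - n a) * (n v ^ 2 - n c ^ 2) - (n v ^ 2 - n a ^ 2) * (n v - n c) ≠ 0 := by
      have : (n v - n a) * (n v ^ 2 - n c ^ 2) - (n v ^ 2 - n a ^ 2) * (n v - n c) =
        - ((n v - n a) * (n v - n c) * (n a - n c)) := by ring
      rw [this]
      exact neg_ne_zero.2 (mul_ne_zero (mul_ne_zero (ninj _ _ hva) (ninj _ _ hvc)) (ninj _ _ hac))
    have := quad_ne (a := det3 p v a c) (b := (p v 0 - p a 0) * (n v ^ 2 - n c ^ 2) +
      (n v - n a) * (p v 1 - p c 1) - (p v 1 - p a 1) * (n v - n c) -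
      (n v ^ 2 - n a ^ 2) * (p v 0 - p c 0)) hD
    filter_upwards [this] with t ht _ _ _ h'
    apply ht
    rw [← h']
    simp [hP, det3]
    ring
  obtain ⟨t, h1, h2, h3⟩ := ((e1.filter_mono nhdsWithin_le_nhds).and (e2.and e3)).exists
  exact ⟨P t, ⟨h2, h3⟩, h1⟩

/-! ### Contraction of a tight set, and the base graph -/

lemma sum_fiber_row [Fintype V] (q : ℝ) (r : V → Fin 2 → ℝ) (c : V → V) (v w x : V) (i : Fin 2) :
    ∑ y ∈ Finset.univ.filter (fun y => c y = x), row q r s(v, w) (y, i) =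
      (if x = c v then co q (r v i - r w i) else 0) -
      (if x = c w then co q (r v i - r w i) else 0) := by
  simp only [row_apply, Finset.sum_sub_distrib, Finset.sum_ite_eq', Finset.mem_filter,
    Finset.mem_univ, true_and, eq_comm (a := x)]

lemma contract [Fintype V] {q : ℝ} (hq : 1 < q) {F : Finset (Sym2 V)} (T : Finset V) {t0 : V}
    (c : V → V) (hcT : ∀ v ∈ T, c v = t0)
    (p r : V → Fin 2 → ℝ) (FT F1 : Finset (Sym2 V)) (hF : F = FT ∪ F1)
    (hdisj : Disjoint FT F1) (hFT : ∀ e ∈ FT, ∀ v ∈ e, v ∈ T)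
    (hinj : InjOn (Sym2.map c) (F1 : Set (Sym2 V)))
    (h1 : Ind q r FT) (h2 : Ind q p (F1.image (Sym2.map c))) : ∃ p', Ind q p' F := by
  set P : ℝ → V → Fin 2 → ℝ := fun t v => if v ∈ T then p (c v) + t • r v else p (c v) with hP
  have hPc : Continuous P := by
    rw [continuous_pi_iff]; intro v
    simp only [hP]
    split_ifs <;> fun_prop
  have P0 : P 0 = p ∘ c := by
    funext v; simp [hP]
  set R : ℝ → Sym2 V → V × Fin 2 → ℝ := fun t e => if e ∈ FT then row q r e else row q (P t) e
    with hR
  have RT : ∀ t, ∀ e ∈ FT, R t e = row q r e := fun t e he => if_pos he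
  have R1 : ∀ t, ∀ e ∈ F1, R t e = row q (P t) e := fun t e he =>
    if_neg (fun h => Finset.disjoint_left.1 hdisj h he)
  have hli : LinearIndepOn ℝ (R 0) (F : Set (Sym2 V)) := by
    rw [linearIndepOn_finset_iff]
    intro f hf
    rw [hF, Finset.sum_union hdisj] at hf
    have h2' : LinearIndepOn ℝ (row q p ∘ Sym2.map c) (F1 : Set (Sym2 V)) := by
      apply LinearIndepOn.comp_of_image _ hinj
      rw [← Finset.coe_image]
      exact h2
    rw [linearIndepOn_finset_iff] at h2'
    have k1 := h2' f (by
      funext ⟨x, i⟩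
      have hs : ∑ y ∈ Finset.univ.filter (fun y => c y = x),
          (∑ e ∈ FT, f e • R 0 e + ∑ e ∈ F1, f e • R 0 e) (y, i) = 0 := by
        rw [hf]; simp
      simp only [Pi.add_apply, Finset.sum_apply, Pi.smul_apply, smul_eq_mul,
        Finset.sum_add_distrib] at hs
      rw [Finset.sum_comm, Finset.sum_comm (t := F1)] at hs
      simp only [← Finset.mul_sum] at hs
      rw [Finset.sum_eq_zero (s := FT), zero_add] at hs
      · rw [Finset.sum_apply, Pi.zero_apply, ← hs]
        apply Finset.sum_congr rfl
        intro e he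
        rw [R1 0 e he, P0]
        induction e using Sym2.ind with
        | _ a b =>
          rw [sum_fiber_row]
          simp [row_apply]
      · intro e he
        rw [RT 0 e he]
        have := hFT e he
        induction e using Sym2.ind with
        | _ a b =>
          rw [sum_fiber_row, hcT a (this a (by simp)), hcT b (this b (by simp)), sub_self, mul_zero])
    have k2 := ind_iff.1 h1 f (by
      rw [← hf, Finset.sum_eq_zero (s := F1), add_zero]
      · apply Finset.sum_congr rfl
        intro e he
        rw [RT 0 e he]
      · intro e he
        rw [k1 e he, zero_smul])
    intro e he
    rw [hF, Finset.mem_union] at he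
    exact he.elim (k2 e) (k1 e)
  have hev := eventually_indep (F := F) (R := R) (by
    intro e _
    simp only [hR]
    split_ifs
    · exact continuous_const
    · exact (row_continuous hq e).comp hPc) hli
  obtain ⟨t, ht, htpos⟩ := ((hev.filter_mono nhdsWithin_le_nhds).and
    (self_mem_nhdsWithin : Ioi (0 : ℝ) ∈ 𝓝[>] (0 : ℝ))).exists
  have htpos : 0 < t := htpos
  refine ⟨P t, ?_⟩
  rw [ind_iff]
  rw [linearIndepOn_finset_iff] at ht
  have hct : co q t ≠ 0 := co_ne_zero htpos.ne'
  intro f hf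
  have hrow : ∀ e ∈ F, row q (P t) e = (if e ∈ FT then co q t else 1) • R t e := by
    intro e he
    rw [hF, Finset.mem_union] at he
    by_cases hT : e ∈ FT
    · rw [if_pos hT, RT t e hT]
      have := hFT e hT
      induction e using Sym2.ind with
      | _ a b =>
        funext ⟨x, i⟩
        have ha := this a (by simp)
        have hb := this b (by simp)
        have hPa : P t a = p t0 + t • r a := by simp [hP, ha, hcT a ha]
        have hPb : P t b = p t0 + t • r b := by simp [hP, hb, hcT b hb]
        have : co q (P t a i - P t b i) = co q t * co q (r a i - r b i) := by
          rw [← co_mul, hPa, hPb]; congr 1; simp; ring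
        rw [Pi.smul_apply, row_apply, row_apply, this, smul_eq_mul]
        split_ifs <;> ring
    · rw [if_neg hT, one_smul, R1 t e (he.resolve_left hT)]
  have k := ht (fun e => f e * (if e ∈ FT then co q t else 1)) (by
    rw [← hf]
    apply Finset.sum_congr rfl
    intro e he
    rw [hrow e he, mul_smul])
  intro e he
  refine (mul_eq_zero.1 (k e he)).resolve_right ?_
  split_ifs
  · exact hct
  · exact one_ne_zero

lemma base_K4 {q : ℝ} (hq2 : q ≠ 2) {a b c d : V} (hab : a ≠ b) (hac : a ≠ c)
    (had : a ≠ d) (hbc : b ≠ c) (hbd : b ≠ d) (hcd : c ≠ d) :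
    ∃ p, Ind q p ({s(a, b), s(a, c), s(b, c), s(a, d), s(b, d), s(c, d)} : Finset (Sym2 V)) := by
  set p : V → Fin 2 → ℝ := fun x => if x = a then ![0, 0] else if x = b then ![1, 0] else
    if x = c then ![0, 1] else ![1 / 2, 2] with hp
  have pa : p a = ![0, 0] := by simp [hp]
  have pb : p b = ![1, 0] := by simp [hp, hab.symm]
  have pc : p c = ![0, 1] := by simp [hp, hac.symm, hbc.symm]
  have pd : p d = ![1 / 2, 2] := by simp [hp, had.symm, hbd.symm, hcd.symm]
  refine ⟨p, ?_⟩
  rw [ind_iff]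
  intro f hf
  rw [Finset.sum_insert (by simp [*, hab.symm, hac.symm, had.symm, hbc.symm, hbd.symm, hcd.symm]),
    Finset.sum_insert (by simp [*, hab.symm, hac.symm, had.symm, hbc.symm, hbd.symm, hcd.symm]),
    Finset.sum_insert (by simp [*, hab.symm, hac.symm, had.symm, hbc.symm, hbd.symm, hcd.symm]),
    Finset.sum_insert (by simp [*, hab.symm, hac.symm, had.symm, hbc.symm, hbd.symm, hcd.symm]),
    Finset.sum_insert (by simp [*, hab.symm, hac.symm, had.symm, hbc.symm, hbd.symm, hcd.symm]),
    Finset.sum_singleton] at hf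
  set z := co q 2 with hz
  set h := co q (1 / 2) with hh
  have hzh : z * h = 1 := by rw [hz, hh, ← co_mul]; norm_num [co_one]
  have hzpos : 0 < z := by rw [hz, co_pos two_pos]; exact Real.rpow_pos_of_pos two_pos _
  have hz2 : z ≠ 2 := by
    intro h2
    rw [hz, co_pos two_pos] at h2
    apply hq2
    have := congrArg (Real.logb 2) h2
    rw [Real.logb_rpow two_pos (by norm_num), Real.logb_self_eq_one (by norm_num)] at this
    linarith
  have hm1 : co q (-1) = -1 := by rw [co_neg, co_one]
  have hm2 : co q (-2) = -z := by rw [co_neg]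
  have hmh : co q (-(1 / 2)) = -h := by rw [co_neg]
  have E : ∀ x i, _ := fun x i => congrFun hf (x, i)
  simp only [Pi.add_apply, Pi.smul_apply, smul_eq_mul, row_apply, pa, pb, pc, pd, Pi.zero_apply] at E
  have a0 := E a 0
  have a1 := E a 1
  have b0 := E b 0
  have b1 := E b 1
  have c0 := E c 0
  have c1 := E c 1
  have d0 := E d 0
  have d1 := E d 1
  simp only [hab, hac, had, hbc, hbd, hcd, hab.symm, hac.symm, had.symm, hbc.symm, hbd.symm,
    hcd.symm, if_true, if_false, Matrix.cons_val_zero, Matrix.cons_val_one] at a0 a1 b0 b1 c0 c1 d0 d1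
  norm_num [co_zero, co_one, hm1, hm2, ← hz] at a0 a1 b0 b1 c0 c1 d0 d1
  have hh' : co q (1 / 2) = h := rfl
  have hmh' : co q (-1 / 2) = - h := by rw [← hmh]; norm_num
  norm_num [hh', hmh'] at a0 a1 b0 b1 c0 c1 d0 d1
  rw [hmh] at a0 c0 d0
  have hh0 : h ≠ 0 := by intro h0; rw [h0, mul_zero] at hzh; exact zero_ne_one hzh
  have g1 : f s(c, d) = z ^ 2 * f s(b, d) := by
    linear_combination z * (b1 - c0) - f s(c, d) * hzh
  have g2 : f s(a, d) = f s(b, d) - f s(c, d) := by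
    have : h * (f s(a, d) - (f s(b, d) - f s(c, d))) = 0 := by linear_combination d0
    exact sub_eq_zero.1 ((mul_eq_zero.1 this).resolve_left hh0)
  have g3 : f s(b, d) = 0 := by
    have : z * (z - 2) * (z + 1) * f s(b, d) = 0 := by
      rw [g2, g1] at d1
      linear_combination -d1
    refine (mul_eq_zero.1 this).resolve_left ?_
    exact mul_ne_zero (mul_ne_zero hzpos.ne' (sub_ne_zero.2 hz2)) (by positivity)
  have g4 : f s(c, d) = 0 := by rw [g1, g3, mul_zero]
  have g5 : f s(a, d) = 0 := by rw [g2, g3, g4, sub_zero]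
  rw [g5] at a0 a1
  rw [g3] at b1
  intro e he
  simp only [Finset.mem_insert, Finset.mem_singleton] at he
  rcases he with rfl | rfl | rfl | rfl | rfl | rfl
  · linarith
  · linarith
  · linarith
  · exact g5
  · exact g3
  · exact g4

/-! ### Sparsity counts and independence -/

def EE (F : Finset (Sym2 V)) (S : Finset V) : Finset (Sym2 V) := F.filter (fun e => ∀ v ∈ e, v ∈ S)

def ic (F : Finset (Sym2 V)) (S : Finset V) : ℕ := (EE F S).card

def Sparse (l : ℕ) (F : Finset (Sym2 V)) : Prop :=
  (∀ e ∈ F, ¬ e.IsDiag) ∧ ∀ S : Finset V, 2 ≤ S.card → ic F S + l ≤ 2 * S.card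

lemma mem_EE {F : Finset (Sym2 V)} {S : Finset V} {e : Sym2 V} :
    e ∈ EE F S ↔ e ∈ F ∧ ∀ v ∈ e, v ∈ S := by simp [EE]

lemma EE_sub (F : Finset (Sym2 V)) (S : Finset V) : EE F S ⊆ F := fun _ he => (mem_EE.1 he).1

lemma mem_EE_mk {F : Finset (Sym2 V)} {S : Finset V} {x y : V} :
    s(x, y) ∈ EE F S ↔ s(x, y) ∈ F ∧ x ∈ S ∧ y ∈ S := by simp [EE]

lemma ic_mono {F F' : Finset (Sym2 V)} {S S' : Finset V} (h : F ⊆ F') (hS : S ⊆ S') :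
    ic F S ≤ ic F' S' := by
  apply Finset.card_le_card
  intro e he
  rw [mem_EE] at he ⊢
  exact ⟨h he.1, fun v hv => hS (he.2 v hv)⟩

lemma EE_inter (F : Finset (Sym2 V)) (A B : Finset V) : EE F A ∩ EE F B = EE F (A ∩ B) := by
  ext e
  simp only [Finset.mem_inter, mem_EE]
  constructor
  · rintro ⟨⟨h1, h2⟩, _, h3⟩
    exact ⟨h1, fun v hv => ⟨h2 v hv, h3 v hv⟩⟩
  · rintro ⟨h1, h2⟩
    exact ⟨⟨h1, fun v hv => (h2 v hv).1⟩, h1, fun v hv => (h2 v hv).2⟩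

lemma EE_subset_left (F : Finset (Sym2 V)) (A B : Finset V) : EE F A ⊆ EE F (A ∪ B) := by
  intro e he
  rw [mem_EE] at he ⊢
  exact ⟨he.1, fun v hv => Finset.mem_union_left _ (he.2 v hv)⟩

lemma EE_subset_right (F : Finset (Sym2 V)) (A B : Finset V) : EE F B ⊆ EE F (A ∪ B) := by
  rw [Finset.union_comm]; exact EE_subset_left F B A

lemma ic_super (F : Finset (Sym2 V)) (A B : Finset V) :
    ic F A + ic F B ≤ ic F (A ∪ B) + ic F (A ∩ B) := by
  unfold ic
  rw [← Finset.card_union_add_card_inter, EE_inter]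
  gcongr
  exact Finset.union_subset (EE_subset_left F A B) (EE_subset_right F A B)

lemma Sparse.mono {l : ℕ} {F F' : Finset (Sym2 V)} (h : Sparse l F') (hF : F ⊆ F') : Sparse l F :=
  ⟨fun e he => h.1 e (hF he), fun S hS => le_trans (by gcongr; exact ic_mono hF subset_rfl) (h.2 S hS)⟩

lemma ic_small {F : Finset (Sym2 V)} (h : ∀ e ∈ F, ¬ e.IsDiag) {S : Finset V} (hS : S.card ≤ 1) :
    ic F S = 0 := by
  unfold ic
  rw [Finset.card_eq_zero, Finset.eq_empty_iff_forall_notMem]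
  intro e he
  rw [mem_EE] at he
  induction e using Sym2.ind with
  | _ a b =>
    apply h _ he.1
    rw [Sym2.mk_isDiag_iff]
    exact Finset.card_le_one.1 hS a (he.2 a (by simp)) b (he.2 b (by simp))

lemma ic_insert_vertex {F F0 : Finset (Sym2 V)} {S N : Finset V} {v : V} (hv : v ∉ S) (hF : F0 ⊆ F)
    (hN : N ⊆ S) (hE : ∀ x ∈ N, s(v, x) ∈ F) : ic F0 S + N.card ≤ ic F (insert v S) := by
  have h1 : (N.image (fun x => s(v, x))).card = N.card := by
    apply Finset.card_image_of_injective
    intro x y h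
    exact Sym2.congr_right.1 h
  unfold ic
  rw [← h1, ← Finset.card_union_of_disjoint]
  · apply Finset.card_le_card
    intro e he
    rw [Finset.mem_union] at he
    rcases he with he | he
    · rw [mem_EE] at he ⊢
      exact ⟨hF he.1, fun w hw => Finset.mem_insert_of_mem (he.2 w hw)⟩
    · rw [Finset.mem_image] at he
      obtain ⟨x, hx, rfl⟩ := he
      rw [mem_EE_mk]
      exact ⟨hE x hx, Finset.mem_insert_self _ _, Finset.mem_insert_of_mem (hN hx)⟩
  · rw [Finset.disjoint_left]
    intro e he he'
    rw [Finset.mem_image] at he'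
    obtain ⟨x, hx, rfl⟩ := he'
    rw [mem_EE_mk] at he
    exact hv he.2.1

lemma not_sparse_insert {l : ℕ} {F : Finset (Sym2 V)} {a b : V} (hab : a ≠ b) (hF : Sparse l F)
    (h : ¬ Sparse l (insert s(a, b) F)) :
    ∃ S : Finset V, a ∈ S ∧ b ∈ S ∧ 2 * S.card ≤ ic F S + l := by
  by_contra! hc
  apply h
  refine ⟨?_, ?_⟩
  · intro e he
    rcases Finset.mem_insert.1 he with rfl | he
    · simpa using hab
    · exact hF.1 e he
  · intro S hS
    by_cases hs : a ∈ S ∧ b ∈ S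
    · have h1 := hc S hs.1 hs.2
      have : ic (insert s(a, b) F) S ≤ ic F S + 1 := by
        unfold ic
        refine le_trans (Finset.card_le_card (t := insert s(a, b) (EE F S)) ?_)
          (Finset.card_insert_le _ _)
        intro e he
        rw [Finset.mem_insert, mem_EE]
        rw [mem_EE, Finset.mem_insert] at he
        rcases he.1 with h | h
        · exact Or.inl h
        · exact Or.inr ⟨h, he.2⟩
      omega
    · refine le_trans ?_ (hF.2 S hS)
      gcongr
      apply Finset.card_le_card
      intro e he
      rw [mem_EE] at he ⊢
      refine ⟨?_, he.2⟩
      rcases Finset.mem_insert.1 he.1 with rfl | h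
      · exact absurd ⟨he.2 a (by simp), he.2 b (by simp)⟩ hs
      · exact h

/-- `S` is a tight set avoiding `v`. -/
def TS (l : ℕ) (F : Finset (Sym2 V)) (v : V) (S : Finset V) : Prop :=
  v ∉ S ∧ 2 * S.card ≤ ic F S + l

lemma TS_of_bad {l : ℕ} {F : Finset (Sym2 V)} {a b v : V} (hab : a ≠ b) (hva : v ≠ a) (hvb : v ≠ b)
    (hF : Sparse l F) (hv : ∀ e ∈ F, v ∉ e) (h : ¬ Sparse l (insert s(a, b) F)) :
    ∃ S : Finset V, a ∈ S ∧ b ∈ S ∧ TS l F v S := by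
  obtain ⟨S, ha, hb, hS⟩ := not_sparse_insert hab hF h
  refine ⟨S, ha, hb, ?_, hS⟩
  intro hvS
  have h1 : ic F S ≤ ic F (S.erase v) := by
    apply Finset.card_le_card
    intro e he
    rw [mem_EE] at he ⊢
    refine ⟨he.1, fun w hw => Finset.mem_erase.2 ⟨?_, he.2 w hw⟩⟩
    rintro rfl
    exact hv e he.1 hw
  have h2 : 2 ≤ (S.erase v).card := by
    rw [← Finset.card_pair hab]
    apply Finset.card_le_card
    intro x hx
    rw [Finset.mem_insert, Finset.mem_singleton] at hx
    rcases hx with rfl | rfl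
    · exact Finset.mem_erase.2 ⟨hva.symm, ha⟩
    · exact Finset.mem_erase.2 ⟨hvb.symm, hb⟩
  have h3 := hF.2 _ h2
  have h4 := Finset.card_erase_of_mem hvS
  omega

section hard
variable {F F0 : Finset (Sym2 V)} {v a b c : V}

lemma no_three {l : ℕ} (hl : l = 2 ∨ l = 3) (hF : Sparse l F) (hF0 : F0 ⊆ F)
    (hab : a ≠ b) (hac : a ≠ c) (hbc : b ≠ c)
    (ea : s(v, a) ∈ F) (eb : s(v, b) ∈ F) (ec : s(v, c) ∈ F) {S : Finset V} (hS : TS l F0 v S)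
    (ha : a ∈ S) (hb : b ∈ S) (hc : c ∈ S) : False := by
  have h3 : ({a, b, c} : Finset V).card = 3 := Finset.card_eq_three.2 ⟨a, b, c, hab, hac, hbc, rfl⟩
  have hsub : ({a, b, c} : Finset V) ⊆ S := by
    intro x hx
    simp only [Finset.mem_insert, Finset.mem_singleton] at hx
    rcases hx with rfl | rfl | rfl <;> assumption
  have h1 := ic_insert_vertex (F := F) hS.1 hF0 hsub (by
    intro x hx
    simp only [Finset.mem_insert, Finset.mem_singleton] at hx
    rcases hx with rfl | rfl | rfl <;> assumption)
  have h4 := Finset.card_le_card hsub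
  have h5 := Finset.card_insert_of_notMem hS.1
  have h2 := hF.2 (insert v S) (by omega)
  have := hS.2
  omega

lemma TS_union {l : ℕ} (hF : Sparse l F0) {A B : Finset V} (hA : TS l F0 v A) (hB : TS l F0 v B)
    (h : 2 ≤ (A ∩ B).card ∨ (l = 2 ∧ 1 ≤ (A ∩ B).card)) : TS l F0 v (A ∪ B) := by
  refine ⟨by simp [hA.1, hB.1], ?_⟩
  have h1 := ic_super F0 A B
  have h2 := Finset.card_union_add_card_inter A B
  have h3 := hA.2
  have h4 := hB.2
  by_cases h5 : 2 ≤ (A ∩ B).card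
  · have := hF.2 _ h5
    omega
  · have := ic_small hF.1 (S := A ∩ B) (by omega)
    omega

lemma hard_two (hF : Sparse 2 F) (hF0 : F0 ⊆ F)
    (hab : a ≠ b) (hac : a ≠ c) (hbc : b ≠ c)
    (ea : s(v, a) ∈ F) (eb : s(v, b) ∈ F) (ec : s(v, c) ∈ F)
    (h1 : s(b, c) ∈ F0 ∨ ∃ S : Finset V, b ∈ S ∧ c ∈ S ∧ TS 2 F0 v S)
    (h2 : s(a, c) ∈ F0 ∨ ∃ S : Finset V, a ∈ S ∧ c ∈ S ∧ TS 2 F0 v S)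
    (h3 : ∃ S : Finset V, a ∈ S ∧ b ∈ S ∧ TS 2 F0 v S) (hvc : v ≠ c) : False := by
  obtain ⟨A, aA, bA, hA⟩ := h3
  have hs := hF.mono hF0
  have key : ∀ S, TS 2 F0 v S → a ∈ S → b ∈ S → c ∈ S → False := fun S =>
    no_three (Or.inl rfl) hF hF0 hab hac hbc ea eb ec
  rcases h1 with h1 | ⟨B, bB, cB, hB⟩
  · rcases h2 with h2 | ⟨B, aB, cB, hB⟩
    · by_cases cA : c ∈ A
      · exact key A hA aA bA cA
      · have h5 := Finset.card_insert_of_notMem cA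
        have := ic_insert_vertex (F := F0) (F0 := F0) (N := {a, b}) cA subset_rfl (by
          intro x hx
          simp only [Finset.mem_insert, Finset.mem_singleton] at hx
          rcases hx with rfl | rfl <;> assumption) (by
          intro x hx
          simp only [Finset.mem_insert, Finset.mem_singleton] at hx
          rcases hx with rfl | rfl <;> rw [Sym2.eq_swap] <;> assumption)
        rw [Finset.card_pair hab] at this
        have h6 := hA.2
        refine key (insert c A) ⟨by simp [hA.1, hvc], by omega⟩ (by simp [aA]) (by simp [bA])
          (by simp)
    · exact key _ (TS_union hs hA hB (Or.inr ⟨rfl, Finset.card_pos.2 ⟨a, by simp [aA, aB]⟩⟩))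
        (by simp [aA]) (by simp [bA]) (by simp [cB])
  · exact key _ (TS_union hs hA hB (Or.inr ⟨rfl, Finset.card_pos.2 ⟨b, by simp [bA, bB]⟩⟩))
        (by simp [aA]) (by simp [bA]) (by simp [cB])

lemma hard_three (hF : Sparse 3 F) (hF0 : F0 ⊆ F)
    (hab : a ≠ b) (hac : a ≠ c) (hbc : b ≠ c)
    (ea : s(v, a) ∈ F) (eb : s(v, b) ∈ F) (ec : s(v, c) ∈ F)
    (h1 : ∃ S : Finset V, b ∈ S ∧ c ∈ S ∧ TS 3 F0 v S)
    (h2 : ∃ S : Finset V, a ∈ S ∧ c ∈ S ∧ TS 3 F0 v S)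
    (h3 : ∃ S : Finset V, a ∈ S ∧ b ∈ S ∧ TS 3 F0 v S) : False := by
  obtain ⟨A, aA, bA, hA⟩ := h3
  obtain ⟨B, bB, cB, hB⟩ := h1
  obtain ⟨C, aC, cC, hC⟩ := h2
  have hs := hF.mono hF0
  have key : ∀ S, TS 3 F0 v S → a ∈ S → b ∈ S → c ∈ S → False := fun S =>
    no_three (Or.inr rfl) hF hF0 hab hac hbc ea eb ec
  have k1 : (A ∩ B).card ≤ 1 := by
    by_contra! h
    exact key _ (TS_union hs hA hB (Or.inl h)) (by simp [aA]) (by simp [bA]) (by simp [cB])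
  have k2 : (A ∩ C).card ≤ 1 := by
    by_contra! h
    exact key _ (TS_union hs hA hC (Or.inl h)) (by simp [aA]) (by simp [bA]) (by simp [cC])
  have k3 : (B ∩ C).card ≤ 1 := by
    by_contra! h
    exact key _ (TS_union hs hB hC (Or.inl h)) (by simp [aC]) (by simp [bB]) (by simp [cC])
  have d1 : (EE F0 A ∩ EE F0 B).card = 0 := by rw [EE_inter]; exact ic_small hs.1 k1
  have d2 : (EE F0 A ∩ EE F0 C).card = 0 := by rw [EE_inter]; exact ic_small hs.1 k2
  have d3 : (EE F0 B ∩ EE F0 C).card = 0 := by rw [EE_inter]; exact ic_small hs.1 k3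
  have n1 := Finset.card_union_add_card_inter A B
  have n2 := Finset.card_union_add_card_inter (A ∪ B) C
  have n3 : 1 ≤ (A ∩ B).card := Finset.card_pos.2 ⟨b, by simp [bA, bB]⟩
  have n4 : 2 ≤ ((A ∪ B) ∩ C).card := by
    rw [← Finset.card_pair hac]
    apply Finset.card_le_card
    intro x hx
    simp only [Finset.mem_insert, Finset.mem_singleton] at hx
    rcases hx with rfl | rfl <;> simp [*]
  have m1 := Finset.card_union_add_card_inter (EE F0 A) (EE F0 B)
  have m2 := Finset.card_union_add_card_inter (EE F0 A ∪ EE F0 B) (EE F0 C)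
  have m3 : ((EE F0 A ∪ EE F0 B) ∩ EE F0 C).card = 0 := by
    rw [Finset.union_inter_distrib_right]
    have := Finset.card_union_le (EE F0 A ∩ EE F0 C) (EE F0 B ∩ EE F0 C)
    omega
  have m4 : (EE F0 A ∪ EE F0 B ∪ EE F0 C).card ≤ ic F0 (A ∪ B ∪ C) := by
    apply Finset.card_le_card
    refine Finset.union_subset ?_ (EE_subset_right _ _ _)
    refine Finset.Subset.trans ?_ (EE_subset_left _ _ _)
    exact Finset.union_subset (EE_subset_left _ _ _) (EE_subset_right _ _ _)
  have t1 := hA.2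
  have t2 := hB.2
  have t3 := hC.2
  unfold ic at t1 t2 t3
  refine key (A ∪ B ∪ C) ⟨by simp [hA.1, hB.1, hC.1], by omega⟩ (by simp [aA]) (by simp [bA])
    (by simp [cC])

/-- Either some 1-reduction is possible, or we see a `K4` (and `l = 2`). -/
lemma hard_case {l : ℕ} (hl : l = 2 ∨ l = 3) (hF : Sparse l F) (hF0 : F0 ⊆ F)
    (hv : ∀ e ∈ F0, v ∉ e) (hva : v ≠ a) (hvb : v ≠ b) (hvc : v ≠ c)
    (hab : a ≠ b) (hac : a ≠ c) (hbc : b ≠ c)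
    (ea : s(v, a) ∈ F) (eb : s(v, b) ∈ F) (ec : s(v, c) ∈ F)
    (h1 : s(b, c) ∈ F0 ∨ ¬ Sparse l (insert s(b, c) F0))
    (h2 : s(a, c) ∈ F0 ∨ ¬ Sparse l (insert s(a, c) F0))
    (h3 : s(a, b) ∈ F0 ∨ ¬ Sparse l (insert s(a, b) F0)) :
    l = 2 ∧ s(b, c) ∈ F0 ∧ s(a, c) ∈ F0 ∧ s(a, b) ∈ F0 := by
  have hs := hF.mono hF0
  replace h1 := h1.imp_right (TS_of_bad hbc hvb hvc hs hv)
  replace h2 := h2.imp_right (TS_of_bad hac hva hvc hs hv)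
  replace h3 := h3.imp_right (TS_of_bad hab hva hvb hs hv)
  rcases hl with rfl | rfl
  · refine ⟨rfl, ?_, ?_, ?_⟩
    · refine h1.resolve_right fun h => ?_
      refine hard_two hF hF0 hbc hab.symm hac.symm eb ec ea ?_ ?_ h hva
      · rw [Sym2.eq_swap]; exact h2.imp_right fun ⟨S, x, y, z⟩ => ⟨S, y, x, z⟩
      · rw [Sym2.eq_swap]; exact h3.imp_right fun ⟨S, x, y, z⟩ => ⟨S, y, x, z⟩
    · refine h2.resolve_right fun h => ?_
      refine hard_two hF hF0 hac hab hbc.symm ea ec eb ?_ h3 h hvb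
      rw [Sym2.eq_swap]; exact h1.imp_right fun ⟨S, x, y, z⟩ => ⟨S, y, x, z⟩
    · refine h3.resolve_right fun h => ?_
      exact hard_two hF hF0 hab hac hbc ea eb ec h1 h2 h hvc
  · exfalso
    have key : ∀ x y : V, x ≠ y → v ≠ x → v ≠ y → (s(x, y) ∈ F0 ∨ ∃ S : Finset V, x ∈ S ∧ y ∈ S ∧ TS 3 F0 v S) →
        ∃ S : Finset V, x ∈ S ∧ y ∈ S ∧ TS 3 F0 v S := by
      intro x y hxy hvx hvy h
      refine h.elim (fun h => ⟨{x, y}, by simp, by simp, by simp [hvx, hvy], ?_⟩) id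
      rw [Finset.card_pair hxy]
      have : 1 ≤ ic F0 {x, y} := Finset.card_pos.2 ⟨s(x, y), by simp [mem_EE_mk, h]⟩
      omega
    exact hard_three hF hF0 hab hac hbc ea eb ec (key _ _ hbc hvb hvc h1) (key _ _ hac hva hvc h2)
      (key _ _ hab hva hvb h3)

end hard

/-! ### Sparse implies independent -/

def nb [Fintype V] (F : Finset (Sym2 V)) (v : V) : Finset V := Finset.univ.filter (fun x => s(v, x) ∈ F)

def del (F : Finset (Sym2 V)) (v : V) : Finset (Sym2 V) := F.filter (fun e => v ∉ e)

def supp [Fintype V] (F : Finset (Sym2 V)) : Finset V := Finset.univ.filter (fun x => ∃ e ∈ F, x ∈ e)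

lemma mem_nb [Fintype V] {F : Finset (Sym2 V)} {v x : V} : x ∈ nb F v ↔ s(v, x) ∈ F := by simp [nb]

lemma mem_supp [Fintype V] {F : Finset (Sym2 V)} {x : V} : x ∈ supp F ↔ ∃ e ∈ F, x ∈ e := by
  simp [supp]

lemma del_notMem {F : Finset (Sym2 V)} {v : V} : ∀ e ∈ del F v, v ∉ e := by
  intro e he; simp only [del, Finset.mem_filter] at he; exact he.2

lemma del_sub {F : Finset (Sym2 V)} {v : V} : del F v ⊆ F := Finset.filter_subset _ _

lemma at_v [Fintype V] (F : Finset (Sym2 V)) (v : V) :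
    F.filter (fun e => v ∈ e) = (nb F v).image (fun x => s(v, x)) := by
  ext e
  simp only [Finset.mem_filter, Finset.mem_image, mem_nb]
  constructor
  · rintro ⟨he, hv⟩
    obtain ⟨y, rfl⟩ := hv
    exact ⟨y, he, rfl⟩
  · rintro ⟨x, hx, rfl⟩
    exact ⟨hx, by simp⟩

lemma decomp [Fintype V] (F : Finset (Sym2 V)) (v : V) :
    F = (nb F v).image (fun x => s(v, x)) ∪ del F v := by
  rw [← at_v, del, Finset.filter_union_filter_not_eq]

lemma card_at [Fintype V] (F : Finset (Sym2 V)) (v : V) :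
    (F.filter (fun e => v ∈ e)).card = (nb F v).card := by
  rw [at_v]
  apply Finset.card_image_of_injective
  intro x y h
  exact Sym2.congr_right.1 h

lemma del_card_lt [Fintype V] {F : Finset (Sym2 V)} {v : V} (h : 1 ≤ (nb F v).card) :
    (del F v).card + (nb F v).card = F.card := by
  rw [← card_at, del, add_comm]
  exact Finset.card_filter_add_card_filter_not _

lemma EE_supp [Fintype V] (F : Finset (Sym2 V)) : EE F (supp F) = F := by
  ext e
  rw [mem_EE]
  exact ⟨fun h => h.1, fun h => ⟨h, fun v hv => mem_supp.2 ⟨e, h, hv⟩⟩⟩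

lemma supp_card [Fintype V] {F : Finset (Sym2 V)} (h : ∀ e ∈ F, ¬ e.IsDiag) (hne : F.Nonempty) :
    2 ≤ (supp F).card := by
  obtain ⟨e, he⟩ := hne
  induction e using Sym2.ind with
  | _ a b =>
    have hab : a ≠ b := by simpa using h _ he
    rw [← Finset.card_pair hab]
    apply Finset.card_le_card
    intro x hx
    simp only [Finset.mem_insert, Finset.mem_singleton] at hx
    rw [mem_supp]
    exact ⟨_, he, by simpa using hx⟩

lemma exists_low [Fintype V] {l : ℕ} (hl : 2 ≤ l) {F : Finset (Sym2 V)} (hF : Sparse l F)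
    (hne : F.Nonempty) : ∃ v ∈ supp F, (nb F v).card ≤ 3 := by
  by_contra! hc
  have h1 := hF.2 (supp F) (supp_card hF.1 hne)
  rw [ic, EE_supp] at h1
  have h2 : ∑ v ∈ supp F, (F.filter (fun e => v ∈ e)).card =
      ∑ e ∈ F, ((supp F).filter (fun v => v ∈ e)).card :=
    Finset.sum_card_bipartiteAbove_eq_sum_card_bipartiteBelow (fun (v : V) (e : Sym2 V) => v ∈ e)
  have h3 : ∑ e ∈ F, ((supp F).filter (fun v => v ∈ e)).card ≤ F.card * 2 := by
    rw [← smul_eq_mul]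
    apply Finset.sum_le_card_nsmul
    intro e he
    induction e using Sym2.ind with
    | _ a b =>
      refine le_trans (Finset.card_le_card (t := {a, b}) ?_) Finset.card_le_two
      intro x hx
      simpa using (Finset.mem_filter.1 hx).2
  have h4 : (supp F).card * 4 ≤ ∑ v ∈ supp F, (F.filter (fun e => v ∈ e)).card := by
    rw [← smul_eq_mul]
    apply Finset.card_nsmul_le_sum
    intro v hv
    rw [card_at]
    exact hc v hv
  omega

lemma nb_pos [Fintype V] {F : Finset (Sym2 V)} {v : V} (hv : v ∈ supp F) : 1 ≤ (nb F v).card := by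
  obtain ⟨e, he, hve⟩ := mem_supp.1 hv
  obtain ⟨y, rfl⟩ := hve
  exact Finset.card_pos.2 ⟨y, mem_nb.2 he⟩

lemma nb_ne [Fintype V] {F : Finset (Sym2 V)} (h : ∀ e ∈ F, ¬ e.IsDiag) {v x : V} (hx : x ∈ nb F v) :
    v ≠ x := by
  simpa using h _ (mem_nb.1 hx)

lemma contract_sparse [Fintype V] {F : Finset (Sym2 V)} (hF : Sparse 2 F) {T : Finset V} {t0 : V}
    (ht0 : t0 ∈ T) (hT2 : 2 ≤ T.card) (hT : 2 * T.card ≤ ic F T + 2) :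
    Sparse 2 ((F \ EE F T).image (Sym2.map (fun w => if w ∈ T then t0 else w))) := by
  set c : V → V := fun w => if w ∈ T then t0 else w with hc
  refine ⟨?_, ?_⟩
  · intro e he
    rw [Finset.mem_image] at he
    obtain ⟨e', he', rfl⟩ := he
    rw [Finset.mem_sdiff] at he'
    induction e' using Sym2.ind with
    | _ a b =>
      have hab : a ≠ b := by simpa using hF.1 _ he'.1
      have h2 := he'.2
      rw [mem_EE_mk] at h2
      rw [Sym2.map_mk, Sym2.mk_isDiag_iff]
      intro h
      simp only [hc] at h
      by_cases ha : a ∈ T <;> by_cases hb : b ∈ T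
      · exact h2 ⟨he'.1, ha, hb⟩
      · rw [if_pos ha, if_neg hb] at h; exact hb (h ▸ ht0)
      · rw [if_neg ha, if_pos hb] at h; exact ha (h ▸ ht0)
      · rw [if_neg ha, if_neg hb] at h; exact hab h
  · intro S hS
    set S' : Finset V := Finset.univ.filter (fun w => c w ∈ S) with hS'
    have h1 : ic ((F \ EE F T).image (Sym2.map c)) S ≤ (EE (F \ EE F T) S').card := by
      refine le_trans (Finset.card_le_card (t := (EE (F \ EE F T) S').image (Sym2.map c)) ?_)
        Finset.card_image_le
      intro e he
      rw [mem_EE, Finset.mem_image] at he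
      obtain ⟨⟨e', he', rfl⟩, h⟩ := he
      rw [Finset.mem_image]
      refine ⟨e', ?_, rfl⟩
      rw [mem_EE]
      refine ⟨he', fun w hw => ?_⟩
      simp only [hS', Finset.mem_filter, Finset.mem_univ, true_and]
      exact h _ (Sym2.mem_map.2 ⟨w, hw, rfl⟩)
    by_cases hS0 : t0 ∈ S
    · have e1 : S' = (S \ T) ∪ T := by
        ext w
        simp only [hS', Finset.mem_filter, Finset.mem_univ, true_and, Finset.mem_union,
          Finset.mem_sdiff, hc]
        split_ifs with hw <;> simp [hw, hS0]
      have e2 : S'.card = (S \ T).card + T.card := by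
        rw [e1, Finset.card_union_of_disjoint Finset.sdiff_disjoint]
      have e3 : (S \ T).card + 1 ≤ S.card := by
        have : S \ T ⊆ S.erase t0 := by
          intro x hx
          rw [Finset.mem_sdiff] at hx
          exact Finset.mem_erase.2 ⟨fun h => hx.2 (h ▸ ht0), hx.1⟩
        have := Finset.card_le_card this
        rw [Finset.card_erase_of_mem hS0] at this
        omega
      have e4 := hF.2 S' (by omega)
      have e5 : (EE (F \ EE F T) S').card + (EE F T).card ≤ ic F S' := by
        rw [← Finset.card_union_of_disjoint]
        · apply Finset.card_le_card
          intro e he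
          rw [Finset.mem_union] at he
          rw [mem_EE]
          rcases he with he | he
          · rw [mem_EE] at he
            exact ⟨(Finset.mem_sdiff.1 he.1).1, he.2⟩
          · rw [mem_EE] at he
            refine ⟨he.1, fun w hw => ?_⟩
            rw [e1]
            exact Finset.mem_union_right _ (he.2 w hw)
        · rw [Finset.disjoint_left]
          intro e he he'
          rw [mem_EE] at he
          exact (Finset.mem_sdiff.1 he.1).2 he'
      unfold ic at hT
      omega
    · have e1 : S' ⊆ S := by
        intro w hw
        simp only [hS', Finset.mem_filter, Finset.mem_univ, true_and, hc] at hw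
        split_ifs at hw with h
        · exact absurd hw hS0
        · exact hw
      have e2 : (EE (F \ EE F T) S').card ≤ ic F S := ic_mono Finset.sdiff_subset e1
      have := hF.2 S hS
      omega

lemma contract_inj {F : Finset (Sym2 V)} {T : Finset V} {t0 : V}
    (ht0 : t0 ∈ T) (hx : ∀ x, x ∉ T → ∀ y ∈ T, ∀ z ∈ T, s(x, y) ∈ F → s(x, z) ∈ F → y = z) :
    InjOn (Sym2.map (fun w => if w ∈ T then t0 else w)) ((F \ EE F T : Finset (Sym2 V)) : Set (Sym2 V)) := by
  have key : ∀ a b c d : V, ¬ (a ∈ T ∧ b ∈ T) → ¬ (c ∈ T ∧ d ∈ T) → s(a, b) ∈ F → s(c, d) ∈ F →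
      (if a ∈ T then t0 else a) = (if c ∈ T then t0 else c) →
      (if b ∈ T then t0 else b) = (if d ∈ T then t0 else d) → s(a, b) = s(c, d) := by
    intro a b c d h1 h2 e1 e2 h3 h4
    have same : ∀ x y : V, (if x ∈ T then t0 else x) = (if y ∈ T then t0 else y) →
        (x ∈ T ∧ y ∈ T) ∨ (x = y ∧ x ∉ T) := by
      intro x y h
      split_ifs at h with hx hy hy
      · exact Or.inl ⟨hx, hy⟩
      · exact absurd (h ▸ ht0) hy
      · exact absurd (h ▸ ht0) hx
      · exact Or.inr ⟨h, hx⟩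
    rcases same _ _ h3 with ⟨ha, hc⟩ | ⟨rfl, ha⟩ <;> rcases same _ _ h4 with ⟨hb, hd⟩ | ⟨rfl, hb⟩
    · exact absurd ⟨ha, hb⟩ h1
    · rw [hx b hb a ha c hc (by rwa [Sym2.eq_swap]) (by rwa [Sym2.eq_swap])]
    · rw [hx a ha b hb d hd e1 e2]
    · rfl
  intro e he e' he' h
  rw [Finset.mem_coe, Finset.mem_sdiff] at he he'
  induction e using Sym2.ind with
  | _ a b =>
  induction e' using Sym2.ind with
  | _ c d =>
    rw [mem_EE_mk] at he he'
    rw [Sym2.map_mk, Sym2.map_mk, Sym2.eq_iff] at h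
    have n1 : ¬ (a ∈ T ∧ b ∈ T) := fun h => he.2 ⟨he.1, h⟩
    have n2 : ¬ (c ∈ T ∧ d ∈ T) := fun h => he'.2 ⟨he'.1, h⟩
    rcases h with ⟨h3, h4⟩ | ⟨h3, h4⟩
    · exact key a b c d n1 n2 he.1 he'.1 h3 h4
    · rw [key a b d c n1 (fun h => n2 h.symm) he.1 (by rw [Sym2.eq_swap]; exact he'.1) h3 h4,
        Sym2.eq_swap]

lemma card_K4 {a b c d : V} (hab : a ≠ b) (hac : a ≠ c)
    (had : a ≠ d) (hbc : b ≠ c) (hbd : b ≠ d) (hcd : c ≠ d) :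
    ({s(a, b), s(a, c), s(b, c), s(a, d), s(b, d), s(c, d)} : Finset (Sym2 V)).card = 6 := by
  rw [Finset.card_insert_of_notMem, Finset.card_insert_of_notMem, Finset.card_insert_of_notMem,
    Finset.card_insert_of_notMem, Finset.card_insert_of_notMem, Finset.card_singleton] <;>
  simp [*, hab.symm, hac.symm, had.symm, hbc.symm, hbd.symm, hcd.symm]

lemma K4_tight {F : Finset (Sym2 V)} {a b c d : V} (hab : a ≠ b) (hac : a ≠ c)
    (had : a ≠ d) (hbc : b ≠ c) (hbd : b ≠ d) (hcd : c ≠ d)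
    (h : ({s(a, b), s(a, c), s(b, c), s(a, d), s(b, d), s(c, d)} : Finset (Sym2 V)) ⊆ F) :
    6 ≤ ic F {a, b, c, d} := by
  rw [← card_K4 hab hac had hbc hbd hcd]
  apply Finset.card_le_card
  intro e he
  rw [mem_EE]
  refine ⟨h he, ?_⟩
  simp only [Finset.mem_insert, Finset.mem_singleton] at he
  rcases he with rfl | rfl | rfl | rfl | rfl | rfl <;> simp

lemma K4_case [Fintype V] {q : ℝ} (hq : 1 < q) (hq2 : q ≠ 2) {F : Finset (Sym2 V)} (hF : Sparse 2 F)
    (IH : ∀ F' : Finset (Sym2 V), F'.card < F.card → Sparse 2 F' → ∃ p, Ind q p F')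
    (deg : ∀ v ∈ supp F, 3 ≤ (nb F v).card) {a b c d : V} (hab : a ≠ b) (hac : a ≠ c)
    (had : a ≠ d) (hbc : b ≠ c) (hbd : b ≠ d) (hcd : c ≠ d)
    (h : ({s(a, b), s(a, c), s(b, c), s(a, d), s(b, d), s(c, d)} : Finset (Sym2 V)) ⊆ F) :
    ∃ p, Ind q p F := by
  set K : Finset V := {a, b, c, d} with hK
  have hK4 : K.card = 4 := Finset.card_eq_four.2 ⟨a, b, c, d, hab, hac, had, hbc, hbd, hcd, rfl⟩
  have hKt : 6 ≤ ic F K := K4_tight hab hac had hbc hbd hcd h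
  by_cases hS : supp F = K
  · obtain ⟨p, hp⟩ := base_K4 hq2 hab hac had hbc hbd hcd
    refine ⟨p, hp.mono ?_⟩
    intro e he
    induction e using Sym2.ind with
    | _ x y =>
      have hx : x ∈ K := by rw [← hS, mem_supp]; exact ⟨_, he, by simp⟩
      have hy : y ∈ K := by rw [← hS, mem_supp]; exact ⟨_, he, by simp⟩
      have hxy : x ≠ y := by simpa using hF.1 _ he
      simp only [hK, Finset.mem_insert, Finset.mem_singleton] at hx hy
      rcases hx with rfl | rfl | rfl | rfl <;> rcases hy with rfl | rfl | rfl | rfl <;> simp_all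
  have hKs : K ⊆ supp F := by
    intro x hx
    simp only [hK, Finset.mem_insert, Finset.mem_singleton] at hx
    rw [mem_supp]
    rcases hx with rfl | rfl | rfl | rfl
    · exact ⟨s(x, b), h (by simp), by simp⟩
    · exact ⟨s(a, x), h (by simp), by simp⟩
    · exact ⟨s(a, x), h (by simp), by simp⟩
    · exact ⟨s(a, x), h (by simp), by simp⟩
  set Fam : Finset (Finset V) := Finset.univ.filter
    (fun T => K ⊆ T ∧ T ⊆ supp F ∧ T ≠ supp F ∧ 2 * T.card ≤ ic F T + 2) with hFam
  obtain ⟨T, hT, hmax⟩ := Finset.exists_max_image Fam Finset.card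
    ⟨K, by
      simp only [hFam, Finset.mem_filter, Finset.mem_univ, true_and]
      exact ⟨subset_rfl, hKs, fun h => hS h.symm, by omega⟩⟩
  simp only [hFam, Finset.mem_filter, Finset.mem_univ, true_and] at hT hmax
  obtain ⟨hKT, hTs, hTne, hTt⟩ := hT
  have hT4 : 4 ≤ T.card := hK4 ▸ Finset.card_le_card hKT
  have haT : a ∈ T := hKT (by simp [hK])
  have hone : ∀ x, x ∉ T → ∀ y ∈ T, ∀ z ∈ T, s(x, y) ∈ F → s(x, z) ∈ F → y = z := by
    intro x hx y hy z hz e1 e2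
    by_contra hyz
    have hxs : x ∈ supp F := mem_supp.2 ⟨_, e1, by simp⟩
    have k1 := ic_insert_vertex (F := F) (F0 := F) (N := {y, z}) hx subset_rfl (by
      intro w hw
      simp only [Finset.mem_insert, Finset.mem_singleton] at hw
      rcases hw with rfl | rfl <;> assumption) (by
      intro w hw
      simp only [Finset.mem_insert, Finset.mem_singleton] at hw
      rcases hw with rfl | rfl <;> assumption)
    rw [Finset.card_pair hyz] at k1
    have k2 := Finset.card_insert_of_notMem hx
    have k3 : insert x T = supp F := by
      by_contra hne
      have := hmax (insert x T) ⟨hKT.trans (Finset.subset_insert _ _),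
        Finset.insert_subset hxs hTs, hne, by omega⟩
      omega
    have k4 := ic_insert_vertex (F := F) (F0 := F) (N := nb F x) hx subset_rfl (by
      intro w hw
      have w1 : w ∈ supp F := mem_supp.2 ⟨_, mem_nb.1 hw, by simp⟩
      rw [← k3, Finset.mem_insert] at w1
      exact w1.resolve_left (nb_ne hF.1 hw).symm) (fun w hw => mem_nb.1 hw)
    have k5 := deg x hxs
    have k6 := hF.2 (insert x T) (by omega)
    omega
  obtain ⟨r, hr⟩ := IH (EE F T) (by
    apply Finset.card_lt_card
    refine ⟨EE_sub _ _, fun hsub => hTne ?_⟩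
    refine Finset.Subset.antisymm hTs ?_
    intro x hx
    obtain ⟨e, he, hxe⟩ := mem_supp.1 hx
    exact (mem_EE.1 (hsub he)).2 x hxe) (hF.mono (EE_sub _ _))
  obtain ⟨p, hp⟩ := IH ((F \ EE F T).image (Sym2.map (fun w => if w ∈ T then a else w))) (by
    refine lt_of_le_of_lt Finset.card_image_le ?_
    rw [Finset.card_sdiff_of_subset (EE_sub _ _)]
    have : (EE F T).card ≤ F.card := Finset.card_le_card (EE_sub _ _)
    unfold ic at hTt
    omega) (contract_sparse hF haT (by omega) hTt)
  exact contract hq T (t0 := a) (fun w => if w ∈ T then a else w) (fun v hv => if_pos hv) p r (EE F T)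
    (F \ EE F T) (Finset.union_sdiff_of_subset (EE_sub _ _)).symm
    Finset.disjoint_sdiff (fun e he => (mem_EE.1 he).2) (contract_inj haT hone) hr hp

/-- the sparsity parameter -/
def ll (q : ℝ) : ℕ := if q = 2 then 3 else 2

lemma ll_or (q : ℝ) : ll q = 2 ∨ ll q = 3 := by unfold ll; split_ifs <;> simp

theorem sparse_ind [Fintype V] {q : ℝ} (hq : 1 < q) : ∀ (n : ℕ) (F : Finset (Sym2 V)), F.card = n →
    Sparse (ll q) F → ∃ p, Ind q p F := by
  intro n
  induction n using Nat.strong_induction_on with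
  | _ n ih =>
  intro F hn hF
  have IH : ∀ F' : Finset (Sym2 V), F'.card < F.card → Sparse (ll q) F' →
      ∃ p, GP p ∧ Ind q p F' := by
    intro F' h h'
    obtain ⟨p, hp⟩ := ih F'.card (hn ▸ h) F' rfl h'
    exact exists_gp hq hp
  rcases F.eq_empty_or_nonempty with rfl | hne
  · exact ⟨fun _ => 0, by rw [ind_iff]; simp⟩
  have hl := ll_or q
  by_cases hlow : ∃ v ∈ supp F, (nb F v).card ≤ 2
  · obtain ⟨v, hv, h2⟩ := hlow
    have h1 := nb_pos hv
    have hc := del_card_lt h1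
    obtain ⟨p, hgp, hp⟩ := IH (del F v) (by omega) (hF.mono del_sub)
    refine ⟨p, ?_⟩
    rw [decomp F v]
    have hcases : (nb F v).card = 1 ∨ (nb F v).card = 2 := by omega
    rcases hcases with h | h
    · obtain ⟨a, ha⟩ := Finset.card_eq_one.1 h
      have hva : v ≠ a := nb_ne hF.1 (by rw [ha]; simp)
      rw [ha, Finset.image_singleton]
      exact ext_one del_notMem hva (hgp.1 _ _ hva) hp
    · obtain ⟨a, c, hac, ha⟩ := Finset.card_eq_two.1 h
      have hva : v ≠ a := nb_ne hF.1 (by rw [ha]; simp)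
      have hvc : v ≠ c := nb_ne hF.1 (by rw [ha]; simp)
      rw [ha, Finset.image_insert, Finset.image_singleton, Finset.insert_union]
      exact ext_two hq del_notMem hva hvc hac (hgp.2 _ _ _ hva hvc hac) hp
  push Not at hlow
  obtain ⟨v, hv, h3⟩ := exists_low (by omega) hF hne
  have h4 := hlow v hv
  obtain ⟨a, b, c, hab, hac, hbc, hN⟩ := Finset.card_eq_three.1 (show (nb F v).card = 3 by omega)
  have na : a ∈ nb F v := by rw [hN]; simp
  have nb' : b ∈ nb F v := by rw [hN]; simp
  have nc : c ∈ nb F v := by rw [hN]; simp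
  have hva : v ≠ a := nb_ne hF.1 na
  have hvb : v ≠ b := nb_ne hF.1 nb'
  have hvc : v ≠ c := nb_ne hF.1 nc
  have hcd := del_card_lt (nb_pos hv)
  have hdec := decomp F v
  rw [hN, Finset.image_insert, Finset.image_insert, Finset.image_singleton] at hdec
  have red : ∀ x y : V, s(x, y) ∉ del F v → Sparse (ll q) (insert s(x, y) (del F v)) →
      ∃ p, GP p ∧ Ind q p (insert s(x, y) (del F v)) := by
    intro x y hxy hs
    apply IH _ _ hs
    rw [Finset.card_insert_of_notMem hxy]
    omega
  by_cases r1 : s(b, c) ∈ del F v ∨ ¬ Sparse (ll q) (insert s(b, c) (del F v))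
  swap
  · push Not at r1
    obtain ⟨p, hgp, hp⟩ := red b c r1.1 r1.2
    obtain ⟨p', hp'⟩ := ext_edge hq del_notMem hvb hvc hva hbc hab.symm hac.symm r1.1 hgp hp
    refine ⟨p', hp'.mono ?_⟩
    conv_lhs => rw [hdec]
    intro e he
    simp only [Finset.mem_union, Finset.mem_insert, Finset.mem_singleton] at he ⊢
    tauto
  by_cases r2 : s(a, c) ∈ del F v ∨ ¬ Sparse (ll q) (insert s(a, c) (del F v))
  swap
  · push Not at r2
    obtain ⟨p, hgp, hp⟩ := red a c r2.1 r2.2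
    obtain ⟨p', hp'⟩ := ext_edge hq del_notMem hva hvc hvb hac hab hbc.symm r2.1 hgp hp
    refine ⟨p', hp'.mono ?_⟩
    conv_lhs => rw [hdec]
    intro e he
    simp only [Finset.mem_union, Finset.mem_insert, Finset.mem_singleton] at he ⊢
    tauto
  by_cases r3 : s(a, b) ∈ del F v ∨ ¬ Sparse (ll q) (insert s(a, b) (del F v))
  swap
  · push Not at r3
    obtain ⟨p, hgp, hp⟩ := red a b r3.1 r3.2
    obtain ⟨p', hp'⟩ := ext_edge hq del_notMem hva hvb hvc hab hac hbc r3.1 hgp hp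
    refine ⟨p', hp'.mono ?_⟩
    conv_lhs => rw [hdec]
    intro e he
    simp only [Finset.mem_union, Finset.mem_insert, Finset.mem_singleton] at he ⊢
    tauto
  obtain ⟨l2, e1, e2, e3⟩ := hard_case hl hF del_sub del_notMem hva hvb hvc hab hac hbc
    (mem_nb.1 na) (mem_nb.1 nb') (mem_nb.1 nc) r1 r2 r3
  have hq2 : q ≠ 2 := by
    rintro rfl
    simp [ll] at l2
  rw [l2] at hF IH
  refine K4_case hq hq2 hF (fun F' h h' => (IH F' h h').imp fun p hp => hp.2) hlow
    hva hvb hvc hab hac hbc ?_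
  intro e he
  simp only [Finset.mem_insert, Finset.mem_singleton] at he
  rcases he with rfl | rfl | rfl | rfl | rfl | rfl
  · exact mem_nb.1 na
  · exact mem_nb.1 nb'
  · exact del_sub e3
  · exact mem_nb.1 nc
  · exact del_sub e2
  · exact del_sub e1

/-! ### Transfer to generic placements -/

lemma rank_eq {W : Type} {q : ℝ} (F : Finset (Sym2 W)) (hF : ∀ e ∈ F, ¬ e.IsDiag) (x : W → Fin 2 → ℝ) :
    rigidityRank q (SimpleGraph.fromEdgeSet (F : Set (Sym2 W))) x =
      (Set.range (fun e : ↥(F : Set (Sym2 W)) => row q x e)).finrank ℝ := by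
  unfold rigidityRank Set.finrank
  have : {r : W × Fin 2 → ℝ | ∃ v w, (SimpleGraph.fromEdgeSet (F : Set (Sym2 W))).Adj v w ∧
      r = rigidityRow q x v w} = Set.range (fun e : ↥(F : Set (Sym2 W)) => row q x e) := by
    ext r
    constructor
    · rintro ⟨v, w, h, rfl⟩
      rw [SimpleGraph.fromEdgeSet_adj] at h
      exact ⟨⟨s(v, w), h.1⟩, rfl⟩
    · rintro ⟨⟨e, he⟩, rfl⟩
      induction e using Sym2.ind with
      | _ a b =>
        refine ⟨a, b, ?_, rfl⟩
        rw [SimpleGraph.fromEdgeSet_adj]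
        exact ⟨he, by simpa using hF _ he⟩
  rw [this]

lemma row_val {W : Set V} (q : ℝ) (p : V → Fin 2 → ℝ) (e : Sym2 W) (x : W) (i : Fin 2) :
    row q (fun y : W => p y.1) e (x, i) = row q p (e.map Subtype.val) (x.1, i) := by
  induction e using Sym2.ind with
  | _ a b =>
    rw [Sym2.map_mk, row_apply, row_apply]
    simp only [Subtype.ext_iff]

theorem gen_ind {q : ℝ} (hq : 1 < q) {p : V → Fin 2 → ℝ} (hp : IsGeneric q p) {F : Finset (Sym2 V)}
    (hF : Sparse (ll q) F) : Ind q p F := by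
  set W : Set V := ⋃ e ∈ F, {x | x ∈ e} with hW
  have hWf : W.Finite := by
    refine F.finite_toSet.biUnion ?_
    intro e _
    induction e using Sym2.ind with
    | _ a b =>
      refine (Set.toFinite ({a, b} : Set V)).subset ?_
      intro x hx
      simpa using hx
  have hFW : ∀ e ∈ F, ∀ x ∈ e, x ∈ W := by
    intro e he x hx
    rw [hW, Set.mem_iUnion₂]
    exact ⟨e, he, hx⟩
  haveI : Fintype W := hWf.fintype
  have vinj : Function.Injective (Sym2.map (Subtype.val : W → V)) :=
    Sym2.map.injective Subtype.val_injective
  set F' : Finset (Sym2 W) := Finset.univ.filter (fun e => e.map Subtype.val ∈ F) with hF'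
  have mF' : ∀ e, e ∈ F' ↔ e.map Subtype.val ∈ F := by simp [hF']
  have him : F'.image (Sym2.map Subtype.val) = F := by
    ext e
    rw [Finset.mem_image]
    constructor
    · rintro ⟨e', he', rfl⟩
      exact (mF' _).1 he'
    · intro he
      have hh := hFW e he
      induction e using Sym2.ind with
      | _ a b =>
        refine ⟨s(⟨a, hh a (by simp)⟩, ⟨b, hh b (by simp)⟩), ?_, by simp⟩
        rw [mF']
        simpa using he
  have hs' : Sparse (ll q) F' := by
    refine ⟨?_, ?_⟩
    · intro e he
      have := hF.1 _ ((mF' _).1 he)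
      induction e using Sym2.ind with
      | _ a b =>
        rw [Sym2.map_mk, Sym2.mk_isDiag_iff] at this
        rw [Sym2.mk_isDiag_iff]
        rintro rfl
        exact this rfl
    · intro S hS
      have hc : (S.image Subtype.val).card = S.card := Finset.card_image_of_injective _ Subtype.val_injective
      have := hF.2 (S.image Subtype.val) (by omega)
      have h2 : ic F' S ≤ ic F (S.image Subtype.val) := by
        unfold ic
        rw [← Finset.card_image_of_injective (EE F' S) vinj]
        apply Finset.card_le_card
        intro e he
        rw [Finset.mem_image] at he
        obtain ⟨e', he', rfl⟩ := he
        rw [mem_EE] at he' ⊢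
        refine ⟨(mF' _).1 he'.1, ?_⟩
        intro v hv
        obtain ⟨w, hw, rfl⟩ := Sym2.mem_map.1 hv
        exact Finset.mem_image_of_mem _ (he'.2 w hw)
      omega
  obtain ⟨p0, hp0⟩ := sparse_ind hq _ F' rfl hs'
  obtain ⟨p0, hgp, hp0⟩ := exists_gp hq hp0
  have hreg := (hp W hWf).2 W subset_rfl (SimpleGraph.fromEdgeSet (F' : Set (Sym2 W)))
  have hle := hreg.2 p0 (fun v w h => hgp.1 v w h.ne)
  rw [rank_eq F' hs'.1, rank_eq F' hs'.1] at hle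
  have h1 : Fintype.card ↥(F' : Set (Sym2 W)) ≤
      (Set.range (fun e : ↥(F' : Set (Sym2 W)) => row q p0 e)).finrank ℝ :=
    linearIndependent_iff_card_le_finrank_span.1 hp0
  have h2 : Ind q (fun y : W => p y.1) F' :=
    linearIndependent_iff_card_le_finrank_span.2 (h1.trans hle)
  rw [ind_iff] at h2 ⊢
  intro f hf
  have h3 := h2 (fun e => f (e.map Subtype.val)) (by
    funext ⟨x, i⟩
    have := congrFun hf (x.1, i)
    rw [← him, Finset.sum_image vinj.injOn] at this
    rw [Finset.sum_apply] at this ⊢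
    rw [Pi.zero_apply] at this ⊢
    rw [← this]
    apply Finset.sum_congr rfl
    intro e _
    rw [Pi.smul_apply, Pi.smul_apply, row_val])
  intro e he
  rw [← him, Finset.mem_image] at he
  obtain ⟨e', he', rfl⟩ := he
  exact h3 e' he'

lemma gen_inj {q : ℝ} {p : V → Fin 2 → ℝ} (hp : IsGeneric q p) {a b : V} (h : a ≠ b) : p a ≠ p b :=
  fun h' => h ((hp {a, b} (Set.toFinite _)).1 (by simp) (by simp) h')

/-! ### Linear algebra: counting and rigidity -/

lemma pair_sum {q : ℝ} {p : V → Fin 2 → ℝ} {S : Finset V} {v w : V} (hv : v ∈ S) (hw : w ∈ S)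
    (u : V → Fin 2 → ℝ) :
    ∑ x : ↥S × Fin 2, row q p s(v, w) (x.1.1, x.2) * u x.1.1 x.2 = pr q p u v w := by
  rw [Fintype.sum_prod_type_right]
  have : ∀ i : Fin 2, ∑ x : ↥S, row q p s(v, w) (x.1, i) * u x.1 i =
      co q (p v i - p w i) * (u v i - u w i) := by
    intro i
    rw [Finset.sum_coe_sort S (fun x => row q p s(v, w) (x, i) * u x i)]
    simp only [row_apply, sub_mul, ite_mul, zero_mul, Finset.sum_sub_distrib, Finset.sum_ite_eq', hv,
      hw, if_true]
    ring
  rw [Fin.sum_univ_two, this, this]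
  rfl

def motL (p : V → Fin 2 → ℝ) (S : Finset V) : (Fin 3 → ℝ) →ₗ[ℝ] (↥S × Fin 2 → ℝ) where
  toFun θ := fun x => mot (θ 0) (θ 1) (θ 2) (p x.1.1) x.2
  map_add' θ η := by
    funext ⟨x, i⟩
    fin_cases i <;> simp [mot] <;> ring
  map_smul' r θ := by
    funext ⟨x, i⟩
    fin_cases i <;> simp [mot] <;> ring

def PP (q : ℝ) : Submodule ℝ (Fin 3 → ℝ) where
  carrier := {θ | q ≠ 2 → θ 0 = 0}
  add_mem' := by
    intro a b ha hb h
    simp [ha h, hb h]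
  zero_mem' := by intro h; rfl
  smul_mem' := by
    intro r a ha h
    simp [ha h]

lemma mem_PP {q : ℝ} {θ : Fin 3 → ℝ} : θ ∈ PP q ↔ (q ≠ 2 → θ 0 = 0) := Iff.rfl

lemma finrank_PP (q : ℝ) : ll q ≤ Module.finrank ℝ (PP q) := by
  unfold ll
  split_ifs with h
  · have : PP q = ⊤ := by
      rw [eq_top_iff]
      intro θ _ h'
      exact absurd h h'
    rw [this, finrank_top]
    simp
  · have h1 := LinearMap.finrank_range_add_finrank_ker (LinearMap.proj (R := ℝ) (φ := fun _ : Fin 3 => ℝ) 0)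
    have h2 := Submodule.finrank_le (LinearMap.range (LinearMap.proj (R := ℝ) (φ := fun _ : Fin 3 => ℝ) 0))
    have h3 : LinearMap.ker (LinearMap.proj (R := ℝ) (φ := fun _ : Fin 3 => ℝ) 0) = PP q := by
      ext θ
      rw [LinearMap.mem_ker, mem_PP]
      exact ⟨fun h' _ => h', fun h' => h' h⟩
    rw [h3] at h1
    simp at h1 h2
    omega

lemma motL_inj {p : V → Fin 2 → ℝ} {S : Finset V} (hinj : ∀ a b, a ≠ b → p a ≠ p b)
    (hS : 2 ≤ S.card) : Function.Injective (motL p S) := by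
  rw [injective_iff_map_eq_zero]
  intro θ hθ
  obtain ⟨a, ha, b, hb, hab⟩ := Finset.one_lt_card.1 hS
  have e : ∀ (x : V) (hx : x ∈ S), θ 1 - θ 0 * p x 1 = 0 ∧ θ 2 + θ 0 * p x 0 = 0 := by
    intro x hx
    have h0 := congrFun hθ (⟨x, hx⟩, 0)
    have h1 := congrFun hθ (⟨x, hx⟩, 1)
    simp [motL, mot] at h0 h1
    exact ⟨h0, h1⟩
  obtain ⟨a0, a1⟩ := e a ha
  obtain ⟨b0, b1⟩ := e b hb
  have h0 : θ 0 = 0 := by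
    by_contra hne
    apply hinj a b hab
    funext i
    fin_cases i
    · have : θ 0 * (p a 0 - p b 0) = 0 := by linear_combination a1 - b1
      exact sub_eq_zero.1 ((mul_eq_zero.1 this).resolve_left hne)
    · have : θ 0 * (p a 1 - p b 1) = 0 := by linear_combination b0 - a0
      exact sub_eq_zero.1 ((mul_eq_zero.1 this).resolve_left hne)
  rw [h0] at a0 a1
  funext i
  fin_cases i
  · exact h0
  · simpa using a0
  · simpa using a1

theorem lin_alg {q : ℝ} (hq : 1 < q) {p : V → Fin 2 → ℝ} {S : Finset V} {F : Finset (Sym2 V)}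
    (hinj : ∀ a b, a ≠ b → p a ≠ p b)
    (hS : 2 ≤ S.card) (hd : ∀ e ∈ F, ¬ e.IsDiag) (hFS : ∀ e ∈ F, ∀ v ∈ e, v ∈ S) (hI : Ind q p F) :
    F.card + ll q ≤ 2 * S.card ∧ (2 * S.card ≤ F.card + ll q →
      ∀ u, (∀ v w, s(v, w) ∈ F → pr q p u v w = 0) →
        ∃ a b c, (q ≠ 2 → a = 0) ∧ ∀ v ∈ S, u v = mot a b c (p v)) := by
  set M : Matrix ↥F (↥S × Fin 2) ℝ := Matrix.of fun e x => row q p e.1 (x.1.1, x.2) with hM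
  have hli : LinearIndependent ℝ M.row := by
    rw [Fintype.linearIndependent_iff]
    intro g hg e
    have := ind_iff.1 hI (fun e => if h : e ∈ F then g ⟨e, h⟩ else 0) (by
      rw [← Finset.sum_coe_sort F]
      funext ⟨x, i⟩
      by_cases hx : x ∈ S
      · have := congrFun hg (⟨x, hx⟩, i)
        rw [Finset.sum_apply] at this ⊢
        rw [Pi.zero_apply] at this ⊢
        rw [← this]
        apply Finset.sum_congr rfl
        intro e _
        simp [hM]
      · rw [Finset.sum_apply]
        apply Finset.sum_eq_zero
        intro e _
        rw [Pi.smul_apply, row_of_notMem, smul_zero]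
        intro h
        exact hx (hFS e.1 e.2 x h)) e.1 e.2
    simpa using this
  have hrank : M.rank = F.card := by
    rw [LinearIndependent.rank_matrix hli, Fintype.card_coe]
  have hrn := LinearMap.finrank_range_add_finrank_ker M.mulVecLin
  have hr2 : Module.finrank ℝ (LinearMap.range M.mulVecLin) = F.card := hrank
  have hdim : Module.finrank ℝ (↥S × Fin 2 → ℝ) = 2 * S.card := by
    simp [mul_comm]
  rw [hr2, hdim] at hrn
  have hker : ∀ u : V → Fin 2 → ℝ, (fun x : ↥S × Fin 2 => u x.1.1 x.2) ∈ LinearMap.ker M.mulVecLin ↔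
      ∀ v w, s(v, w) ∈ F → pr q p u v w = 0 := by
    intro u
    rw [LinearMap.mem_ker, Matrix.mulVecLin_apply]
    constructor
    · intro h v w he
      have := congrFun h ⟨s(v, w), he⟩
      rw [← pair_sum (hFS _ he v (by simp)) (hFS _ he w (by simp)) u]
      exact this
    · intro h
      funext ⟨e, he⟩
      induction e using Sym2.ind with
      | _ v w =>
        rw [Pi.zero_apply, ← h v w he, ← pair_sum (hFS _ he v (by simp)) (hFS _ he w (by simp)) u]
        rfl
  have hle : (PP q).map (motL p S) ≤ LinearMap.ker M.mulVecLin := by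
    rintro _ ⟨θ, hθ, rfl⟩
    refine (hker (fun v => mot (θ 0) (θ 1) (θ 2) (p v))).2 ?_
    intro v w he
    have hvw : v ≠ w := by simpa using hd _ he
    exact motion_pr hq (mot_isMotion hθ) p (hinj _ _ hvw)
  have hf1 : Module.finrank ℝ ((PP q).map (motL p S)) = Module.finrank ℝ (PP q) :=
    (Submodule.equivMapOfInjective (motL p S) (motL_inj hinj hS) (PP q)).finrank_eq.symm
  have hf2 := finrank_PP q
  have hf3 := Submodule.finrank_mono hle
  refine ⟨by omega, ?_⟩
  intro ht u hu
  have heq := Submodule.eq_of_le_of_finrank_le hle (by omega)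
  have hu' := (hker u).2 hu
  rw [← heq] at hu'
  obtain ⟨θ, hθ, hθu⟩ := hu'
  refine ⟨θ 0, θ 1, θ 2, hθ, ?_⟩
  intro v hv
  funext i
  exact (congrFun hθu (⟨v, hv⟩, i)).symm

/-! ### Sparse graphs, duality and rigid pieces -/

lemma ic_le_choose {F : Finset (Sym2 V)} (hF : ∀ e ∈ F, ¬ e.IsDiag) (S : Finset V) :
    ic F S ≤ S.card.choose 2 := by
  rw [← Sym2.card_image_offDiag]
  apply Finset.card_le_card
  intro e he
  rw [mem_EE] at he
  induction e using Sym2.ind with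
  | _ a b =>
    rw [Finset.mem_image]
    refine ⟨(a, b), ?_, rfl⟩
    rw [Finset.mem_offDiag]
    exact ⟨he.2 a (by simp), he.2 b (by simp), by simpa using hF _ he.1⟩

lemma ic_le_card (F : Finset (Sym2 V)) (S : Finset V) : ic F S ≤ F.card :=
  Finset.card_le_card (EE_sub _ _)

lemma sparse_small {F : Finset (Sym2 V)} (hF : ∀ e ∈ F, ¬ e.IsDiag) (h3 : F.card ≤ 3) (q : ℝ) :
    Sparse (ll q) F := by
  refine ⟨hF, fun S hS => ?_⟩
  have h1 := ic_le_choose hF S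
  have h2 := ic_le_card F S
  have h4 := ll_or q
  by_cases h : S.card = 2
  · rw [h] at h1 ⊢
    have : Nat.choose 2 2 = 1 := rfl
    omega
  · omega

lemma Ind.sparse {q : ℝ} (hq : 1 < q) {p : V → Fin 2 → ℝ} (hp : IsGeneric q p) {F : Finset (Sym2 V)}
    (hF : ∀ e ∈ F, ¬ e.IsDiag) (h : Ind q p F) : Sparse (ll q) F :=
  ⟨hF, fun S hS => (lin_alg hq (fun _ _ h => gen_inj hp h) hS (fun e he => hF e (EE_sub _ _ he))
    (fun e he => (mem_EE.1 he).2) (h.mono (EE_sub F S))).1⟩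

lemma gen_det {q : ℝ} (hq : 1 < q) {p : V → Fin 2 → ℝ} (hp : IsGeneric q p) {v a c : V}
    (hva : v ≠ a) (hvc : v ≠ c) (hac : a ≠ c) : det3 p v a c ≠ 0 := by
  intro hdet
  have hne : p v ≠ p a := gen_inj hp hva
  have hI : Ind q p {s(v, a), s(v, c), s(a, c)} := by
    apply gen_ind hq hp
    apply sparse_small _ Finset.card_le_three
    intro e he
    simp only [Finset.mem_insert, Finset.mem_singleton] at he
    rcases he with rfl | rfl | rfl <;> simpa
  obtain ⟨t, ht⟩ : ∃ t : ℝ, ∀ i, p v i - p c i = t * (p v i - p a i) := by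
    unfold det3 at hdet
    by_cases h0 : p v 0 - p a 0 = 0
    · have h1 : p v 1 - p a 1 ≠ 0 := by
        intro h1
        apply hne
        funext i
        fin_cases i
        · exact sub_eq_zero.1 h0
        · exact sub_eq_zero.1 h1
      refine ⟨(p v 1 - p c 1) / (p v 1 - p a 1), ?_⟩
      intro i
      fin_cases i
      · rw [h0, zero_mul, zero_sub, neg_eq_zero] at hdet
        simp only [Fin.zero_eta]
        rw [h0, mul_zero]
        exact (mul_eq_zero.1 hdet).resolve_left h1
      · simp only [Fin.mk_one]
        field_simp
    · refine ⟨(p v 0 - p c 0) / (p v 0 - p a 0), ?_⟩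
      intro i
      fin_cases i
      · simp only [Fin.zero_eta]
        field_simp
      · simp only [Fin.mk_one]
        field_simp
        linear_combination hdet
  have ht0 : t ≠ 0 := by
    rintro rfl
    apply gen_inj hp hvc
    funext i
    have := ht i
    linarith
  have ht1 : t - 1 ≠ 0 := by
    intro h
    have h1 : t = 1 := by linarith
    apply gen_inj hp hac
    funext i
    have := ht i
    rw [h1] at this
    linarith
  have n1 : s(v, a) ∉ ({s(v, c), s(a, c)} : Finset (Sym2 V)) := by
    simp [hva, hvc, hac, hva.symm, hvc.symm, hac.symm]
  have n2 : s(v, c) ∉ ({s(a, c)} : Finset (Sym2 V)) := by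
    simp [hva, hvc, hac, hva.symm, hvc.symm, hac.symm]
  have n3 : s(v, c) ≠ s(v, a) := by
    intro h; apply n1; rw [← h]; simp
  have n4 : s(a, c) ≠ s(v, a) := by
    intro h; apply n1; rw [← h]; simp
  have n5 : s(a, c) ≠ s(v, c) := by
    intro h; apply n2; rw [← h]; simp
  have key := ind_iff.1 hI (fun e => if e = s(v, a) then - (co q t * co q (t - 1)) else
    if e = s(v, c) then co q (t - 1) else - co q t) (by
      rw [Finset.sum_insert n1, Finset.sum_insert n2, Finset.sum_singleton]
      rw [if_pos rfl, if_neg n3, if_pos rfl, if_neg n4, if_neg n5]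
      funext ⟨x, i⟩
      have c1 : co q (p v i - p c i) = co q t * co q (p v i - p a i) := by rw [ht, co_mul]
      have c2 : co q (p a i - p c i) = co q (t - 1) * co q (p v i - p a i) := by
        rw [← co_mul]
        congr 1
        linear_combination ht i
      simp only [Pi.add_apply, Pi.smul_apply, smul_eq_mul, row_apply, c1, c2, Pi.zero_apply]
      split_ifs <;> ring) s(v, a) (by simp)
  rw [if_pos rfl, neg_eq_zero] at key
  exact mul_ne_zero (co_ne_zero ht0) (co_ne_zero ht1) key

def RigidSub (q : ℝ) (G : SimpleGraph V) (p : V → Fin 2 → ℝ) (S : Finset V) : Prop :=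
  ∀ u, (∀ v ∈ S, ∀ w ∈ S, G.Adj v w → pr q p u v w = 0) →
    ∃ a b c, (q ≠ 2 → a = 0) ∧ ∀ v ∈ S, u v = mot a b c (p v)

def Full (q : ℝ) (G : SimpleGraph V) (p : V → Fin 2 → ℝ) : Prop :=
  ∀ u, (∀ v w, G.Adj v w → pr q p u v w = 0) → ∀ x y, x ≠ y → pr q p u x y = 0

lemma tight_rigid {q : ℝ} (hq : 1 < q) {p : V → Fin 2 → ℝ} (hp : IsGeneric q p)
    {F : Finset (Sym2 V)} (hFG : ∀ e ∈ F, e ∈ G.edgeSet) (hI : Ind q p F) {S : Finset V}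
    (hS : 2 ≤ S.card) (ht : 2 * S.card ≤ ic F S + ll q) : RigidSub q G p S := by
  intro u hu
  refine (lin_alg hq (fun _ _ h => gen_inj hp h) hS
    (fun e he => G.not_isDiag_of_mem_edgeSet (hFG e (EE_sub _ _ he)))
    (fun e he => (mem_EE.1 he).2) (hI.mono (EE_sub F S))).2 ht u ?_
  intro v w he
  rw [mem_EE_mk] at he
  exact hu v he.2.1 w he.2.2 (hFG _ he.1)

lemma row_supp_finite (q : ℝ) (p : V → Fin 2 → ℝ) (e : Sym2 V) :
    (Function.support (row q p e)).Finite := by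
  induction e using Sym2.ind with
  | _ a b =>
    refine (((Set.toFinite ({a, b} : Set V)).prod (Set.toFinite (univ : Set (Fin 2))))).subset ?_
    rintro ⟨x, i⟩ hx
    rw [Function.mem_support] at hx
    refine ⟨?_, mem_univ _⟩
    by_contra hc
    apply hx
    apply row_of_notMem
    simpa using hc

def frow (q : ℝ) (p : V → Fin 2 → ℝ) (e : Sym2 V) : V × Fin 2 →₀ ℝ :=
  Finsupp.ofSupportFinite (row q p e) (row_supp_finite q p e)

lemma frow_mk (q : ℝ) (p : V → Fin 2 → ℝ) (v w : V) : frow q p s(v, w) =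
    (Finsupp.single (v, 0) (co q (p v 0 - p w 0)) - Finsupp.single (w, 0) (co q (p v 0 - p w 0))) +
    (Finsupp.single (v, 1) (co q (p v 1 - p w 1)) - Finsupp.single (w, 1) (co q (p v 1 - p w 1))) := by
  ext ⟨x, i⟩
  change row q p s(v, w) (x, i) = _
  rw [row_apply]
  fin_cases i <;>
  simp [Finsupp.single_apply, eq_comm (a := x)]

lemma phi_frow {q : ℝ} {p : V → Fin 2 → ℝ} (φ : (V × Fin 2 →₀ ℝ) →ₗ[ℝ] ℝ) (v w : V) :
    φ (frow q p s(v, w)) = pr q p (fun x i => φ (Finsupp.single (x, i) 1)) v w := by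
  have h : ∀ x (r : ℝ), φ (Finsupp.single x r) = r * φ (Finsupp.single x 1) := by
    intro x r
    rw [← smul_eq_mul, ← map_smul, Finsupp.smul_single, smul_eq_mul, mul_one]
  rw [frow_mk, map_add, map_sub, map_sub, h (v, 0), h (w, 0), h (v, 1), h (w, 1)]
  unfold pr
  ring

lemma mem_span_of_full {q : ℝ} {p : V → Fin 2 → ℝ} (hfull : Full q G p) {x y : V} (hxy : x ≠ y) :
    row q p s(x, y) ∈ Submodule.span ℝ (row q p '' G.edgeSet) := by
  have h1 : frow q p s(x, y) ∈ Submodule.span ℝ (frow q p '' G.edgeSet) := by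
    by_contra hc
    obtain ⟨φ, hφ, hle⟩ := Submodule.exists_le_ker_of_notMem hc
    apply hφ
    rw [phi_frow]
    apply hfull _ _ x y hxy
    intro v w hvw
    rw [← phi_frow]
    exact hle (Submodule.subset_span ⟨s(v, w), hvw, rfl⟩)
  have h2 := Submodule.mem_map_of_mem (f := (Finsupp.lcoeFun : (V × Fin 2 →₀ ℝ) →ₗ[ℝ] _)) h1
  rw [Submodule.map_span, ← Set.image_comp] at h2
  exact h2

lemma nonadj_rigid {q : ℝ} (hq : 1 < q) {p : V → Fin 2 → ℝ} (hp : IsGeneric q p)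
    (hfull : Full q G p) {x y : V} (hxy : x ≠ y) (hadj : ¬ G.Adj x y) :
    ∃ S : Finset V, x ∈ S ∧ y ∈ S ∧ RigidSub q G p S := by
  have h1 := mem_span_of_full hfull hxy
  obtain ⟨b, hb, -, hspan, hbI⟩ := exists_linearIndepOn_extension
    (linearIndepOn_empty ℝ (row q p)) (empty_subset G.edgeSet)
  have h2 : row q p s(x, y) ∈ Submodule.span ℝ (row q p '' b) := Submodule.span_le.2 hspan h1
  obtain ⟨l, hl, hls⟩ := (Finsupp.mem_span_image_iff_linearCombination ℝ).1 h2
  rw [Finsupp.mem_supported] at hl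
  set F := l.support with hF
  have hFI : Ind q p F := LinearIndepOn.mono hbI hl
  have hFG : ∀ e ∈ F, e ∈ G.edgeSet := fun e he => hb (hl he)
  have hFs : Sparse (ll q) F := hFI.sparse hq hp fun e he => G.not_isDiag_of_mem_edgeSet (hFG e he)
  have hn : s(x, y) ∉ F := fun h => hadj (hFG _ h)
  have hns : ¬ Sparse (ll q) (insert s(x, y) F) := by
    intro hs
    have := gen_ind hq hp hs
    unfold Ind at this
    rw [Finset.coe_insert, linearIndepOn_insert (by exact_mod_cast hn)] at this
    apply this.2
    exact (Finsupp.mem_span_image_iff_linearCombination ℝ).2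
      ⟨l, (Finsupp.mem_supported ℝ l).2 subset_rfl, hls⟩
  obtain ⟨S, hx, hy, hS⟩ := not_sparse_insert hxy hFs hns
  exact ⟨S, hx, hy, tight_rigid hq hp hFG hFI (Finset.one_lt_card.2 ⟨x, hx, y, hy, hxy⟩) hS⟩

lemma rigid_union {q : ℝ} (hq2 : q ≠ 2) {p : V → Fin 2 → ℝ} {S S' : Finset V} {z : V}
    (hz : z ∈ S) (hz' : z ∈ S') (h : RigidSub q G p S) (h' : RigidSub q G p S') :
    RigidSub q G p (S ∪ S') := by
  intro u hu
  obtain ⟨a, b, c, ha, hm⟩ := h u fun v hv w hw =>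
    hu v (Finset.mem_union_left _ hv) w (Finset.mem_union_left _ hw)
  obtain ⟨a', b', c', ha', hm'⟩ := h' u fun v hv w hw =>
    hu v (Finset.mem_union_right _ hv) w (Finset.mem_union_right _ hw)
  have hz1 := (hm z hz).symm.trans (hm' z hz')
  rw [ha hq2] at hm hz1
  rw [ha' hq2] at hm' hz1
  have e0 := congrFun hz1 0
  have e1 := congrFun hz1 1
  simp [mot] at e0 e1
  refine ⟨0, b, c, fun _ => rfl, ?_⟩
  intro v hv
  rcases Finset.mem_union.1 hv with hv | hv
  · exact hm v hv
  · rw [e0, e1]; exact hm' v hv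

lemma rigid_insert {q : ℝ} (hq : 1 < q) (hq2 : q ≠ 2) {p : V → Fin 2 → ℝ} (hp : IsGeneric q p)
    {S : Finset V} {a a' b : V} (ha : a ∈ S) (ha' : a' ∈ S) (haa : a ≠ a')
    (h1 : G.Adj b a) (h2 : G.Adj b a') (h : RigidSub q G p S) : RigidSub q G p (insert b S) := by
  intro u hu
  obtain ⟨r, s, t, hr, hm⟩ := h u fun v hv w hw =>
    hu v (Finset.mem_insert_of_mem hv) w (Finset.mem_insert_of_mem hw)
  rw [hr hq2] at hm
  refine ⟨0, s, t, fun _ => rfl, ?_⟩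
  intro v hv
  rcases Finset.mem_insert.1 hv with rfl | hv
  · have p1 := hu v (Finset.mem_insert_self _ _) a (Finset.mem_insert_of_mem ha) h1
    have p2 := hu v (Finset.mem_insert_self _ _) a' (Finset.mem_insert_of_mem ha') h2
    have hd := co_det hq (gen_det hq hp h1.ne h2.ne haa)
    unfold pr at p1 p2
    rw [hm a ha] at p1
    rw [hm a' ha'] at p2
    simp [mot] at p1 p2
    funext i
    fin_cases i
    · simp only [mot, Fin.zero_eta, Matrix.cons_val_zero]
      rw [zero_mul, sub_zero, ← sub_eq_zero]
      refine (mul_eq_zero.1 (?_ : _ * (u v 0 - s) = 0)).resolve_left hd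
      linear_combination co q (p v 1 - p a' 1) * p1 - co q (p v 1 - p a 1) * p2
    · simp only [mot, Fin.mk_one, Matrix.cons_val_one]
      simp only [Matrix.cons_val_fin_one, zero_mul, add_zero]
      rw [← sub_eq_zero]
      refine (mul_eq_zero.1 (?_ : _ * (u v 1 - t) = 0)).resolve_left hd
      linear_combination -co q (p v 0 - p a' 0) * p1 + co q (p v 0 - p a 0) * p2
  · exact hm v hv

lemma pair_rigid [Infinite V] {q : ℝ} (hq : 1 < q) {p : V → Fin 2 → ℝ} (hp : IsGeneric q p)
    (hfull : Full q G p) {x y : V} (hxy : x ≠ y) :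
    ∃ S : Finset V, x ∈ S ∧ y ∈ S ∧ RigidSub q G p S := by
  by_cases hq2 : q = 2
  · by_cases hadj : G.Adj x y
    · refine ⟨{x, y}, by simp, by simp, ?_⟩
      have hd : ∀ e ∈ ({s(x, y)} : Finset (Sym2 V)), ¬ e.IsDiag := by
        intro e he
        rw [Finset.mem_singleton] at he
        subst he
        simpa
      apply tight_rigid hq hp (F := {s(x, y)})
      · intro e he
        rw [Finset.mem_singleton] at he
        subst he
        exact hadj
      · exact gen_ind hq hp (sparse_small hd (by simp) q)
      · rw [Finset.card_pair hxy]
      · rw [Finset.card_pair hxy]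
        have : 1 ≤ ic ({s(x, y)} : Finset (Sym2 V)) {x, y} :=
          Finset.card_pos.2 ⟨s(x, y), by simp [mem_EE_mk]⟩
        simp only [ll, hq2, if_true]
        omega
    · exact nonadj_rigid hq hp hfull hxy hadj
  · set R : V → V → Prop := fun x y => ∃ S : Finset V, x ∈ S ∧ y ∈ S ∧ RigidSub q G p S with hR
    have Rt : ∀ {a b c : V}, R a b → R a c → R b c := by
      rintro a b c ⟨S, h1, h2, h3⟩ ⟨S', h1', h2', h3'⟩
      exact ⟨S ∪ S', by simp [h2], by simp [h2'], rigid_union hq2 h1 h1' h3 h3'⟩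
    have Rs : ∀ {a b : V}, R a b → R b a := by
      rintro a b ⟨S, h1, h2, h3⟩
      exact ⟨S, h2, h1, h3⟩
    have Rn : ∀ {a b : V}, a ≠ b → ¬ R a b → G.Adj a b := by
      intro a b hab hn
      by_contra hadj
      exact hn (nonadj_rigid hq hp hfull hab hadj)
    by_cases hex : ∃ a a', a ≠ a' ∧ R a a'
    · obtain ⟨a, a', haa, S, haS, ha'S, hS⟩ := hex
      have haR : R a a' := ⟨S, haS, ha'S, hS⟩
      have hall : ∀ b, R a b := by
        intro b
        by_contra hb
        have hba : b ≠ a := by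
          rintro rfl
          exact hb ⟨S, haS, haS, hS⟩
        have hb' : ¬ R b a' := fun h => hb (Rt (Rs haR) (Rs h))
        have hba' : b ≠ a' := by
          rintro rfl
          exact hb haR
        have e1 := Rn hba fun h => hb (Rs h)
        have e2 := Rn hba' hb'
        exact hb ⟨insert b S, by simp [haS], by simp,
          rigid_insert hq hq2 hp haS ha'S haa e1 e2 hS⟩
      exact Rt (hall x) (hall y)
    · exfalso
      push Not at hex
      have adj : ∀ {a b : V}, a ≠ b → G.Adj a b := fun h => Rn h (hex _ _ h)
      obtain ⟨K, hK⟩ := Infinite.exists_subset_card_eq V 4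
      obtain ⟨a, b, c, d, hab, hac, had, hbc, hbd, hcd, rfl⟩ := Finset.card_eq_four.1 hK
      set F : Finset (Sym2 V) := {s(a, b), s(a, c), s(b, c), s(a, d), s(b, d), s(c, d)} with hF
      have hFG : ∀ e ∈ F, e ∈ G.edgeSet := by
        intro e he
        simp only [hF, Finset.mem_insert, Finset.mem_singleton] at he
        rcases he with rfl | rfl | rfl | rfl | rfl | rfl <;>
          exact adj (by assumption)
      have hFd : ∀ e ∈ F, ¬ e.IsDiag := fun e he => G.not_isDiag_of_mem_edgeSet (hFG e he)
      have hl : ll q = 2 := if_neg hq2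
      have hF6 : F.card = 6 := card_K4 hab hac had hbc hbd hcd
      have hs : Sparse (ll q) F := by
        rw [hl]
        refine ⟨hFd, fun S hS => ?_⟩
        have h1 := ic_le_choose hFd S
        have h2 := ic_le_card F S
        by_cases h4 : 4 ≤ S.card
        · omega
        · have hc : S.card = 2 ∨ S.card = 3 := by omega
          rcases hc with h | h <;> rw [h] at h1 ⊢ <;> simp [Nat.choose] at h1 <;> omega
      refine hex a b hab ⟨{a, b, c, d}, by simp, by simp,
        tight_rigid hq hp hFG (gen_ind hq hp hs) (by omega) ?_⟩
      have := K4_tight (F := F) hab hac had hbc hbd hcd subset_rfl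
      omega

lemma mot_unique {p : V → Fin 2 → ℝ} {x y : V} (hxy : p x ≠ p y) {a b c a' b' c' : ℝ}
    (hx : mot a b c (p x) = mot a' b' c' (p x)) (hy : mot a b c (p y) = mot a' b' c' (p y)) :
    mot a b c = mot a' b' c' := by
  have x0 := congrFun hx 0
  have x1 := congrFun hx 1
  have y0 := congrFun hy 0
  have y1 := congrFun hy 1
  simp [mot] at x0 x1 y0 y1
  have ha : a - a' = 0 := by
    by_contra hne
    apply hxy
    funext i
    fin_cases i
    · have : (a - a') * (p x 0 - p y 0) = 0 := by linear_combination x1 - y1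
      exact sub_eq_zero.1 ((mul_eq_zero.1 this).resolve_left hne)
    · have : (a - a') * (p x 1 - p y 1) = 0 := by linear_combination y0 - x0
      exact sub_eq_zero.1 ((mul_eq_zero.1 this).resolve_left hne)
  have ha' : a = a' := by linarith
  subst ha'
  have hb : b = b' := by linarith
  have hc : c = c' := by linarith
  rw [hb, hc]

lemma rigid_step [Infinite V] {q : ℝ} (hq : 1 < q) {p : V → Fin 2 → ℝ} (hp : IsGeneric q p)
    (hfull : Full q G p) {S : Finset V} (hS2 : 2 ≤ S.card) (hS : RigidSub q G p S) (v : V) :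
    ∃ S' : Finset V, S ⊆ S' ∧ v ∈ S' ∧ RigidSub q G p S' := by
  by_cases hv : v ∈ S
  · exact ⟨S, subset_rfl, hv, hS⟩
  obtain ⟨x, hx, y, hy, hxy⟩ := Finset.one_lt_card.1 hS2
  have hxv : x ≠ v := fun h => hv (h ▸ hx)
  have hyv : y ≠ v := fun h => hv (h ▸ hy)
  obtain ⟨S1, x1, v1, h1⟩ := pair_rigid hq hp hfull hxv
  obtain ⟨S2, y2, v2, h2⟩ := pair_rigid hq hp hfull hyv
  refine ⟨S ∪ S1 ∪ S2, fun z hz => by simp [hz], by simp [v1], ?_⟩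
  intro u hu
  obtain ⟨a, b, c, ha, hm⟩ := hS u fun v hv w hw => hu v (by simp [hv]) w (by simp [hw])
  obtain ⟨a1, b1, c1, ha1, hm1⟩ := h1 u fun v hv w hw => hu v (by simp [hv]) w (by simp [hw])
  obtain ⟨a2, b2, c2, ha2, hm2⟩ := h2 u fun v hv w hw => hu v (by simp [hv]) w (by simp [hw])
  have ex := (hm x hx).symm.trans (hm1 x x1)
  have ev := (hm1 v v1).symm.trans (hm2 v v2)
  have ey := (hm y hy).symm.trans (hm2 y y2)
  have ex0 := congrFun ex 0
  have ex1 := congrFun ex 1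
  have ev0 := congrFun ev 0
  have ev1 := congrFun ev 1
  have ey0 := congrFun ey 0
  have ey1 := congrFun ey 1
  simp [mot] at ex0 ex1 ev0 ev1 ey0 ey1
  have hd := gen_det hq hp hxy.symm hyv hxv
  unfold det3 at hd
  have l0 : (a - a1) * (p x 0 - p y 0) + (a1 - a2) * (p v 0 - p y 0) = 0 := by
    linear_combination ex1 + ev1 - ey1
  have l1 : (a - a1) * (p x 1 - p y 1) + (a1 - a2) * (p v 1 - p y 1) = 0 := by
    linear_combination ey0 - ex0 - ev0
  have q1 : a - a1 = 0 := by
    refine (mul_eq_zero.1 (?_ : (a - a1) * _ = 0)).resolve_right hd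
    linear_combination (p v 1 - p y 1) * l0 - (p v 0 - p y 0) * l1
  have q2 : a1 - a2 = 0 := by
    refine (mul_eq_zero.1 (?_ : (a1 - a2) * _ = 0)).resolve_right hd
    linear_combination (p x 0 - p y 0) * l1 - (p x 1 - p y 1) * l0
  have r1 : a1 = a := by linarith
  have r2 : a2 = a := by linarith
  rw [r1] at hm1 ex0 ex1
  rw [r2] at hm2 ey0 ey1
  have s1 : b1 = b := by linarith
  have s2 : c1 = c := by linarith
  have s3 : b2 = b := by linarith
  have s4 : c2 = c := by linarith
  rw [s1, s2] at hm1
  rw [s3, s4] at hm2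
  refine ⟨a, b, c, ha, ?_⟩
  intro z hz
  rcases Finset.mem_union.1 hz with hz | hz
  · rcases Finset.mem_union.1 hz with hz | hz
    · exact hm z hz
    · exact hm1 z hz
  · exact hm2 z hz

lemma flex_pr {q : ℝ} (hq : 1 < q) {p u : V → Fin 2 → ℝ} (hp : IsGeneric q p)
    {H : SimpleGraph V} : IsQFlex q H p u ↔ ∀ v w, H.Adj v w → pr q p u v w = 0 := by
  constructor
  · intro h v w hvw
    exact (flex_iff hq p u (gen_inj hp hvw.ne)).1 (h hvw)
  · intro h v w hvw
    exact (flex_iff hq p u (gen_inj hp hvw.ne)).2 (h v w hvw)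

lemma seq_of_rigid [Countable V] {q : ℝ} (hq : 1 < q) {p : V → Fin 2 → ℝ} (hp : IsGeneric q p)
    (h : QInfRigid q G p) : ∃ T : Tower G, VertexComplete T ∧ ∀ k, QSubInfRigid q (T.seq k) p := by
  cases finite_or_infinite V with
  | inl hf =>
    refine ⟨⟨fun _ => ⊤, fun _ => le_rfl, fun _ => Set.toFinite _⟩, ?_, ?_⟩
    · exact Set.eq_univ_of_forall fun v => Set.mem_iUnion.2 ⟨0, Set.mem_univ v⟩
    · intro k u hu
      have : IsQFlex q G p u := fun v w hvw => hu (v := v) (w := w) (by simpa using hvw)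
      obtain ⟨γ, hγ, h2⟩ := h u this
      exact ⟨γ, hγ, fun v _ => h2 v (Set.mem_univ v)⟩
  | inr hi =>
    have hfull : Full q G p := by
      intro u hu x y hxy
      obtain ⟨γ, hγ, h2⟩ := h u ((flex_pr hq hp).2 hu)
      have : u = fun z => γ (p z) := funext fun v => h2 v (Set.mem_univ v)
      rw [this]
      exact motion_pr hq hγ p (gen_inj hp hxy)
    obtain ⟨e, he⟩ := exists_surjective_nat V
    obtain ⟨x, y, hxy⟩ := exists_pair_ne V
    obtain ⟨S0, hx, hy, hS0⟩ := pair_rigid hq hp hfull hxy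
    have hc : 2 ≤ S0.card := by
      have := Finset.one_lt_card.2 ⟨x, hx, y, hy, hxy⟩
      omega
    have step : ∀ (S : {S : Finset V // 2 ≤ S.card ∧ RigidSub q G p S}) (v : V),
        ∃ S' : {S : Finset V // 2 ≤ S.card ∧ RigidSub q G p S}, S.1 ⊆ S'.1 ∧ v ∈ S'.1 := by
      intro S v
      obtain ⟨S', h1, h2, h3⟩ := rigid_step hq hp hfull S.2.1 S.2.2 v
      exact ⟨⟨S', S.2.1.trans (Finset.card_le_card h1), h3⟩, h1, h2⟩
    choose f hf1 hf2 using step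
    let s : ℕ → {S : Finset V // 2 ≤ S.card ∧ RigidSub q G p S} :=
      fun n => Nat.rec ⟨S0, hc, hS0⟩ (fun k S => f S (e k)) n
    have hs : ∀ k, s (k + 1) = f (s k) (e k) := fun k => rfl
    refine ⟨⟨fun k => (⊤ : G.Subgraph).induce ((s k).1 : Set V), fun k => ?_, fun k => ?_⟩, ?_, ?_⟩
    · apply SimpleGraph.Subgraph.induce_mono_right
      rw [hs]
      exact_mod_cast hf1 (s k) (e k)
    · exact Finset.finite_toSet _
    · refine Set.eq_univ_of_forall fun v => ?_
      obtain ⟨k, rfl⟩ := he v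
      refine Set.mem_iUnion.2 ⟨k + 1, ?_⟩
      have := hf2 (s k) (e k)
      rw [← hs] at this
      exact this
    · intro k u hu
      have hu' := (flex_pr hq hp).1 hu
      obtain ⟨a, b, c, ha, h2⟩ := (s k).2.2 u (by
        intro v hv w hw hvw
        apply hu'
        simp [hv, hw, hvw])
      exact ⟨_, mot_isMotion ha, fun v hv => h2 v hv⟩

lemma rigid_of_seq {q : ℝ} (hq : 1 < q) {p : V → Fin 2 → ℝ} (hp : IsGeneric q p)
    (T : Tower G) (hT : VertexComplete T) (h : ∀ k, QSubInfRigid q (T.seq k) p) :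
    QInfRigid q G p := by
  intro u hu
  have hk : ∀ k, IsQTrivialOn q p (T.seq k).verts u := fun k =>
    h k u (fun v w hvw => hu (by
      have : (T.seq k).Adj v w := by simpa using hvw
      exact this.adj_sub))
  have hmono : Monotone T.seq := monotone_nat_of_le_succ T.mono
  have hex : ∀ v, ∃ k, v ∈ (T.seq k).verts := by
    intro v
    have : v ∈ ⋃ k, (T.seq k).verts := by
      rw [hT]
      trivial
    exact Set.mem_iUnion.1 this
  choose k hkv using hex
  cases finite_or_infinite V with
  | inl hf =>
    obtain ⟨M, hM⟩ := (Set.finite_range k).bddAbove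
    obtain ⟨γ, hγ, h2⟩ := hk M
    exact ⟨γ, hγ, fun v _ => h2 v ((hmono (hM ⟨v, rfl⟩)).1 (hkv v))⟩
  | inr hi =>
    have hpr : ∀ x y, x ≠ y → pr q p u x y = 0 := by
      intro x y hxy
      obtain ⟨γ, hγ, h2⟩ := hk (max (k x) (k y))
      have h3 := motion_pr hq hγ p (gen_inj hp hxy)
      unfold pr at h3 ⊢
      rw [h2 x ((hmono (le_max_left _ _)).1 (hkv x)), h2 y ((hmono (le_max_right _ _)).1 (hkv y))]
      exact h3
    have hfull : Full q (⊤ : SimpleGraph V) p := fun u hu x y hxy => hu x y hxy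
    obtain ⟨x, y, hxy⟩ := exists_pair_ne V
    obtain ⟨S0, hx, hy, hS0⟩ := pair_rigid hq hp hfull hxy
    have hc : 2 ≤ S0.card := by
      have := Finset.one_lt_card.2 ⟨x, hx, y, hy, hxy⟩
      omega
    obtain ⟨a, b, c, ha, h0⟩ := hS0 u (fun v _ w _ hvw => hpr v w hvw)
    refine ⟨mot a b c, mot_isMotion ha, fun v _ => ?_⟩
    obtain ⟨S', h1, h2, h3⟩ := rigid_step hq hp hfull hc hS0 v
    obtain ⟨a', b', c', ha', h4⟩ := h3 u (fun v _ w _ hvw => hpr v w hvw)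
    rw [h4 v h2, mot_unique (gen_inj hp hxy) ((h0 x hx).symm.trans (h4 x (h1 hx)))
      ((h0 y hy).symm.trans (h4 y (h1 hy)))]

theorem statement_1 {V : Type} [Countable V] (G : SimpleGraph V) {q : ℝ} (hq : 1 < q) :
    Rigid q 2 G ↔ SeqRigid q 2 G := by
  constructor
  · intro h p hp
    exact seq_of_rigid hq hp (h p hp)
  · intro h p hp
    obtain ⟨T, hT, h2⟩ := h p hp
    exact rigid_of_seq hq hp T hT h2

end RigidityPaper
end
end
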